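/- Suppose q is an I^n-neighbor of complementary dimension r over a field k of characteristic ≠ 2. If r < 2^{n−1}, then all r-dimensional complementary forms of q are isometric; i.e., if σ_r and σ_r′ are r-dimensional forms over k with q ⟂ σ_r ∈ I^n(k) and q ⟂ σ_r′ ∈ I^n(k), then σ_r ≃ σ_r′. -/

import Mathlib

/-!  Diagonal quadratic forms over a field of characteristic ≠ 2.
In characteristic ≠ 2 every regular quadratic form is isometric to a diagonal form
`⟨d 1, …, d n⟩`, so we model (regular) quadratic forms by their diagonal
coefficient functions. -/

/-- The diagonal quadratic form `⟨d i⟩_{i : ι}` over `k`. -/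
noncomputable def diagQF (k : Type) [Field k] {ι : Type} [Fintype ι] (d : ι → k) :
    QuadraticForm k (ι → k) :=
  QuadraticMap.weightedSumSquares k d

/-- Isometry of (diagonal) quadratic forms. -/
def FormIsom (k : Type) [Field k] {ι κ : Type} [Fintype ι] [Fintype κ]
    (d : ι → k) (e : κ → k) : Prop :=
  QuadraticMap.Equivalent (diagQF k d) (diagQF k e)

/-- The orthogonal sum of `m` copies of the hyperbolic plane `⟨1, -1⟩`. -/
def hypForm (k : Type) [Field k] (m : ℕ) : Fin (2 * m) → k :=
  fun j => if j.val % 2 = 0 then 1 else -1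

/-- The Witt index of a (diagonal) form: the largest `m` such that the form is isometric
to `m·ℍ ⟂ (rest)` for some diagonal form `rest`. -/
noncomputable def wittIndex (k : Type) [Field k] {ι : Type} [Fintype ι] (d : ι → k) : ℕ :=
  sSup {m : ℕ | ∃ (s : ℕ) (e : Fin s → k), FormIsom k d (Sum.elim (hypForm k m) e)}
/-- Witt equivalence of (diagonal) quadratic forms: the two forms become isometric after
adding suitable numbers of hyperbolic planes. -/
def wittEquiv (k : Type) [Field k] {ι κ : Type} [Fintype ι] [Fintype κ]
    (d : ι → k) (e : κ → k) : Prop :=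
  ∃ a b : ℕ, FormIsom k (Sum.elim d (hypForm k a)) (Sum.elim e (hypForm k b))

/-- The Witt class of a (diagonal) form lies in `I^n(k)`, the `n`-th power of the
fundamental ideal of the Witt ring: equivalently (since `I^n(k)` is additively generated
by the `n`-fold Pfister forms, and `-⟨⟨a₁,…,aₙ⟩⟩ = ⟨-1⟩·⟨⟨a₁,…,aₙ⟩⟩` in the Witt ring),
the form is Witt equivalent to an orthogonal sum of scaled `n`-fold Pfister forms
`c_s · ⟨⟨a_{s,1}, …, a_{s,n}⟩⟩`.  The diagonal entries of `⟨⟨a₁,…,aₙ⟩⟩` are indexed by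
the subsets `S ⊆ {1,…,n}`, with entry `∏_{u ∈ S} a_u`. -/
def inIpow (k : Type) [Field k] (n : ℕ) {ι : Type} [Fintype ι] (d : ι → k) : Prop :=
  ∃ (t : ℕ) (c : Fin t → k) (a : Fin t → Fin n → k),
    (∀ s, c s ≠ 0) ∧ (∀ s u, a s u ≠ 0) ∧
    wittEquiv k d (fun p : Fin t × Finset (Fin n) => c p.1 * ∏ u ∈ p.2, a p.1 u)

/-- `q` is an `I^n`-neighbor of complementary dimension `r`: there exists an
`r`-dimensional (regular) form `σ` with `0 ≤ r < dim q` such that the Witt class of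
`q ⟂ σ` lies in `I^n(k)`. -/
def isIneighbor (k : Type) [Field k] (n : ℕ) {m : ℕ} (d : Fin m → k) (r : ℕ) : Prop :=
  r < m ∧ ∃ σ : Fin r → k, (∀ t, σ t ≠ 0) ∧ inIpow k n (Sum.elim d σ)


namespace HS

open Finset

section basics
variable {k : Type} [Field k] {ι κ : Type} [Fintype ι] [Fintype κ]

/-- multiset of values -/
def ms {α : Type} {ι : Type} [Fintype ι] (d : ι → α) : Multiset α := Finset.univ.val.map d

/-- diagonal form -/
def Qd {R : Type} [CommRing R] {ι : Type} [Fintype ι] (d x : ι → R) : R := ∑ i, d i * x i ^ 2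

/-- diagonal bilinear form -/
def Bd {R : Type} [CommRing R] {ι : Type} [Fintype ι] (d x y : ι → R) : R := ∑ i, d i * x i * y i

/-- isometry -/
def IsoF (d : ι → k) (e : κ → k) : Prop :=
  ∃ P : (ι → k) ≃ₗ[k] (κ → k), ∀ x, Qd e (P x) = Qd d x

lemma isoF_iff (d : ι → k) (e : κ → k) : IsoF d e ↔ FormIsom k d e := by
  constructor
  · rintro ⟨P, hP⟩
    refine ⟨⟨P, fun m => ?_⟩⟩
    have := hP m
    simp only [Qd, pow_two] at this
    simpa [diagQF, QuadraticMap.weightedSumSquares_apply] using this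
  · rintro ⟨P⟩
    refine ⟨P.toLinearEquiv, fun m => ?_⟩
    have := P.map_app m
    simp only [diagQF, QuadraticMap.weightedSumSquares_apply, smul_eq_mul] at this
    simp only [Qd, pow_two]
    exact this

lemma IsoF.symm {d : ι → k} {e : κ → k} (h : IsoF d e) : IsoF e d := by
  obtain ⟨P, hP⟩ := h
  exact ⟨P.symm, fun x => by rw [← hP]; simp⟩

lemma IsoF.trans {μ : Type} [Fintype μ] {d : ι → k} {e : κ → k} {f : μ → k}
    (h : IsoF d e) (h' : IsoF e f) : IsoF d f := by
  obtain ⟨P, hP⟩ := h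
  obtain ⟨P', hP'⟩ := h'
  exact ⟨P.trans P', fun x => by simp [hP, hP']⟩

lemma IsoF.refl (d : ι → k) : IsoF d d := ⟨LinearEquiv.refl _ _, fun x => rfl⟩

lemma ms_card {α : Type} (d : ι → α) : Multiset.card (ms d) = Fintype.card ι := by
  simp [ms]

lemma exists_rep {α : Type} (s : Multiset α) : ∃ d : Fin (Multiset.card s) → α, ms d = s := by
  induction s using Quotient.inductionOn with
  | h l =>
    refine ⟨fun i => l.get i, ?_⟩
    simp only [ms, Fin.univ_val_map]
    simp

lemma ms_equiv {α : Type} (d : ι → α) (σ : κ ≃ ι) : ms (d ∘ σ) = ms d := by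
  unfold ms
  rw [← Multiset.map_map]
  congr 1
  simp

lemma ms_eq {α : Type} {d : ι → α} {e : κ → α} (h : ms d = ms e) : ∃ σ : ι ≃ κ, e ∘ σ = d := by
  classical
  have hc : ∀ a, Fintype.card {i // d i = a} = Fintype.card {i // e i = a} := by
    intro a
    have := congrArg (Multiset.count a) h
    simp only [ms, Multiset.count_map] at this
    rw [Fintype.card_subtype, Fintype.card_subtype]
    simp only [Finset.card, Finset.filter_val]
    simpa [eq_comm] using this
  let E : (a : α) → {i // d i = a} ≃ {i // e i = a} := fun a => Fintype.equivOfCardEq (hc a)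
  refine ⟨(Equiv.sigmaFiberEquiv d).symm.trans
    ((Equiv.sigmaCongrRight E).trans (Equiv.sigmaFiberEquiv e)), ?_⟩
  funext i
  simp only [Function.comp, Equiv.trans_apply]
  exact ((E (d i)) ⟨i, rfl⟩).2

lemma isoF_of_equiv (e : κ → k) (σ : ι ≃ κ) : IsoF (e ∘ σ) e := by
  refine ⟨LinearEquiv.funCongrLeft k k σ.symm, fun x => ?_⟩
  simp only [Qd]
  rw [← Equiv.sum_comp σ]
  simp

lemma isoF_of_ms {d : ι → k} {e : κ → k} (h : ms d = ms e) : IsoF d e := by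
  obtain ⟨σ, rfl⟩ := ms_eq h
  exact isoF_of_equiv e σ

/-- option cons -/
def oc {α : Type} {ι : Type} (a : α) (d : ι → α) : Option ι → α := fun o => o.elim a d

@[simp] lemma oc_none {α : Type} (a : α) (d : ι → α) : oc a d none = a := rfl
@[simp] lemma oc_some {α : Type} (a : α) (d : ι → α) (i : ι) : oc a d (some i) = d i := rfl

lemma ms_oc {α : Type} (a : α) (d : ι → α) : ms (oc a d) = a ::ₘ ms d := by
  have : (Finset.univ : Finset (Option ι)) = Finset.insertNone Finset.univ := by ext x; simp
  rw [ms, this]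
  simp [Finset.insertNone, ms]
  rfl

lemma ms_sum {α : Type} (d : ι → α) (e : κ → α) : ms (Sum.elim d e) = ms d + ms e := by
  simp only [ms, ← Finset.univ_disjSum_univ, Finset.val_disjSum, Multiset.disjSum,
    Multiset.map_add, Multiset.map_map]
  rfl

lemma ms_map {α β : Type} (f : α → β) (d : ι → α) : (ms d).map f = ms (f ∘ d) := by
  simp [ms]

lemma Qd_oc {R : Type} [CommRing R] (a : R) (d : ι → R) (x : Option ι → R) :
    Qd (oc a d) x = a * x none ^ 2 + Qd d (fun i => x (some i)) := by
  simp [Qd, Fintype.sum_option]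

lemma Qd_sum {R : Type} [CommRing R] (d : ι → R) (e : κ → R) (x : ι ⊕ κ → R) :
    Qd (Sum.elim d e) x = Qd d (fun i => x (Sum.inl i)) + Qd e (fun i => x (Sum.inr i)) := by
  simp [Qd, Fintype.sum_sum_type]

lemma Qd_add {R : Type} [CommRing R] (d x y : ι → R) :
    Qd d (x + y) = Qd d x + Qd d y + 2 * Bd d x y := by
  simp only [Qd, Bd, Finset.mul_sum, ← Finset.sum_add_distrib]
  refine Finset.sum_congr rfl fun i _ => ?_
  simp only [Pi.add_apply]; ring

lemma Qd_smul {R : Type} [CommRing R] (d x : ι → R) (c : R) :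
    Qd d (c • x) = c ^ 2 * Qd d x := by
  simp only [Qd, Finset.mul_sum]
  refine Finset.sum_congr rfl fun i _ => ?_
  simp only [Pi.smul_apply, smul_eq_mul]; ring

lemma Bd_smul_left {R : Type} [CommRing R] (d x y : ι → R) (c : R) :
    Bd d (c • x) y = c * Bd d x y := by
  simp only [Bd, Finset.mul_sum]
  refine Finset.sum_congr rfl fun i _ => ?_
  simp only [Pi.smul_apply, smul_eq_mul]; ring

lemma Bd_smul_right {R : Type} [CommRing R] (d x y : ι → R) (c : R) :
    Bd d x (c • y) = c * Bd d x y := by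
  simp only [Bd, Finset.mul_sum]
  refine Finset.sum_congr rfl fun i _ => ?_
  simp only [Pi.smul_apply, smul_eq_mul]; ring

@[simp] lemma Qd_zero {R : Type} [CommRing R] (d : ι → R) : Qd d 0 = 0 := by simp [Qd]

lemma Qd_map {R S : Type} [CommRing R] [CommRing S] (f : R →+* S) (d x : ι → R) :
    Qd (f ∘ d) (f ∘ x) = f (Qd d x) := by
  simp [Qd]

lemma Qd_scale {R : Type} [CommRing R] (c : R) (d x : ι → R) :
    Qd (fun i => c * d i) x = c * Qd d x := by
  simp only [Qd, Finset.mul_sum, mul_assoc]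

/-- represented value -/
def Val (s : Multiset k) (c : k) : Prop :=
  ∃ (n : ℕ) (d : Fin n → k), ms d = s ∧ ∃ x, Qd d x = c

/-- isotropic -/
def Isot (s : Multiset k) : Prop :=
  ∃ (n : ℕ) (d : Fin n → k), ms d = s ∧ ∃ x, x ≠ 0 ∧ Qd d x = 0

/-- metabolic functions -/
def MetF {ι : Type} [Fintype ι] (d : ι → k) : Prop :=
  ∃ L : Submodule k (ι → k), Fintype.card ι ≤ 2 * Module.finrank k L ∧ ∀ x ∈ L, Qd d x = 0

/-- metabolic -/
def Met (s : Multiset k) : Prop :=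
  ∃ (n : ℕ) (d : Fin n → k), ms d = s ∧ MetF d

lemma IsoF.metF {d : ι → k} {e : κ → k} (h : IsoF d e) (hd : MetF d) : MetF e := by
  obtain ⟨P, hP⟩ := h
  obtain ⟨L, hL, hQ⟩ := hd
  refine ⟨L.map (P : (ι → k) →ₗ[k] (κ → k)), ?_, ?_⟩
  · rw [LinearEquiv.finrank_map_eq]
    have := P.finrank_eq
    simp only [Module.finrank_pi] at this
    omega
  · rintro _ ⟨x, hx, rfl⟩
    exact (hP x).trans (hQ x hx)

lemma val_iff (d : ι → k) (c : k) : Val (ms d) c ↔ ∃ x, Qd d x = c := by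
  constructor
  · rintro ⟨n, e, he, x, hx⟩
    obtain ⟨P, hP⟩ := isoF_of_ms he
    exact ⟨P x, by rw [hP, hx]⟩
  · rintro ⟨x, hx⟩
    obtain ⟨e, he⟩ := exists_rep (ms d)
    obtain ⟨P, hP⟩ := isoF_of_ms he.symm
    exact ⟨_, e, he, P x, by rw [hP, hx]⟩

lemma isot_iff (d : ι → k) : Isot (ms d) ↔ ∃ x, x ≠ 0 ∧ Qd d x = 0 := by
  constructor
  · rintro ⟨n, e, he, x, h0, hx⟩
    obtain ⟨P, hP⟩ := isoF_of_ms he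
    exact ⟨P x, by simpa using h0, by rw [hP, hx]⟩
  · rintro ⟨x, h0, hx⟩
    obtain ⟨e, he⟩ := exists_rep (ms d)
    obtain ⟨P, hP⟩ := isoF_of_ms he.symm
    exact ⟨_, e, he, P x, by simpa using h0, by rw [hP, hx]⟩

lemma met_iff (d : ι → k) : Met (ms d) ↔ MetF d := by
  constructor
  · rintro ⟨n, e, he, h⟩
    exact (isoF_of_ms he).metF h
  · intro h
    obtain ⟨e, he⟩ := exists_rep (ms d)
    exact ⟨_, e, he, (isoF_of_ms he.symm).metF h⟩

/-- isometry of multisets -/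
def IsoM (s t : Multiset k) : Prop :=
  ∃ (n m : ℕ) (d : Fin n → k) (e : Fin m → k), ms d = s ∧ ms e = t ∧ IsoF d e

lemma isoM_iff (d : ι → k) (e : κ → k) : IsoM (ms d) (ms e) ↔ IsoF d e := by
  constructor
  · rintro ⟨n, m, d', e', hd, he, h⟩
    exact ((isoF_of_ms hd.symm).trans h).trans (isoF_of_ms he)
  · intro h
    obtain ⟨d', hd⟩ := exists_rep (ms d)
    obtain ⟨e', he⟩ := exists_rep (ms e)
    exact ⟨_, _, d', e', hd, he, ((isoF_of_ms hd).trans h).trans (isoF_of_ms he.symm)⟩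

lemma IsoM.symm {s t : Multiset k} (h : IsoM s t) : IsoM t s := by
  obtain ⟨n, m, d, e, rfl, rfl, h⟩ := h
  exact (isoM_iff _ _).2 h.symm

lemma IsoM.trans {s t u : Multiset k} (h : IsoM s t) (h' : IsoM t u) : IsoM s u := by
  obtain ⟨n, m, d, e, rfl, rfl, h⟩ := h
  obtain ⟨n', m', d', e', hd', rfl, h'⟩ := h'
  exact (isoM_iff _ _).2 ((h.trans (isoF_of_ms hd'.symm)).trans h')

lemma IsoM.refl (s : Multiset k) : IsoM s s := by
  obtain ⟨d, hd⟩ := exists_rep s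
  rw [← hd]
  exact (isoM_iff _ _).2 (IsoF.refl d)

lemma IsoM.met {s t : Multiset k} (h : IsoM s t) : Met s → Met t := by
  obtain ⟨n, m, d, e, rfl, rfl, h⟩ := h
  rw [met_iff, met_iff]
  exact h.metF

lemma IsoM.isot {s t : Multiset k} (h : IsoM s t) : Isot s → Isot t := by
  obtain ⟨n, m, d, e, rfl, rfl, P, hP⟩ := h
  rw [isot_iff, isot_iff]
  rintro ⟨x, h0, hx⟩
  exact ⟨P x, by simpa using h0, by rw [hP, hx]⟩

/-- chain equivalence -/
inductive Ch : Multiset k → Multiset k → Prop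
  | refl (s) : Ch s s
  | symm {s t} : Ch s t → Ch t s
  | trans {s t u} : Ch s t → Ch t u → Ch s u
  | sq (a x : k) (u) : x ≠ 0 → Ch (a ::ₘ u) ((a * x ^ 2) ::ₘ u)
  | pair (a b : k) (u) : a ≠ 0 → b ≠ 0 → a + b ≠ 0 →
      Ch (a ::ₘ b ::ₘ u) ((a + b) ::ₘ (a * b * (a + b)) ::ₘ u)

lemma isoF_sq (a x : k) (hx : x ≠ 0) (d : ι → k) : IsoF (oc a d) (oc (a * x ^ 2) d) := by
  refine ⟨LinearEquiv.ofLinearMap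
    { toFun := fun y o => o.elim (y none / x) (fun i => y (some i))
      map_add' := ?_
      map_smul' := ?_ }
    { toFun := fun y o => o.elim (y none * x) (fun i => y (some i))
      map_add' := ?_
      map_smul' := ?_ } ?_ ?_, ?_⟩
  · intro y z; funext o; rcases o with _ | i <;> simp [add_div]
  · intro y z; funext o; rcases o with _ | i <;> simp [mul_div_assoc]
  · intro y z; funext o; rcases o with _ | i <;> simp [add_mul]
  · intro y z; funext o; rcases o with _ | i <;> simp [mul_assoc]
  · refine LinearMap.ext fun y => ?_
    funext o; rcases o with _ | i <;> simp [hx]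
  · refine LinearMap.ext fun y => ?_
    funext o; rcases o with _ | i <;> simp [hx]
  · intro y
    simp [Qd_oc]
    field_simp

lemma isoF_pair (a b : k) (h : a + b ≠ 0) (d : ι → k) :
    IsoF (oc a (oc b d)) (oc (a + b) (oc (a * b * (a + b)) d)) := by
  refine ⟨LinearEquiv.ofLinearMap
    { toFun := fun y o => o.elim ((a * y none + b * y (some none)) / (a + b))
        (fun o => o.elim ((y none - y (some none)) / (a + b)) (fun i => y (some (some i))))
      map_add' := ?_
      map_smul' := ?_ }
    { toFun := fun y o => o.elim (y none + b * y (some none))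
        (fun o => o.elim (y none - a * y (some none)) (fun i => y (some (some i))))
      map_add' := ?_
      map_smul' := ?_ } ?_ ?_, ?_⟩
  · intro y z; funext o; rcases o with _ | _ | i <;> simp <;> ring
  · intro y z; funext o; rcases o with _ | _ | i <;> simp <;> ring
  · intro y z; funext o; rcases o with _ | _ | i <;> simp <;> ring
  · intro y z; funext o; rcases o with _ | _ | i <;> simp <;> ring
  · refine LinearMap.ext fun y => ?_
    funext o; rcases o with _ | _ | i <;> simp <;> field_simp <;> ring
  · refine LinearMap.ext fun y => ?_
    funext o; rcases o with _ | _ | i <;> simp <;> field_simp <;> ring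
  · intro y
    simp [Qd_oc]
    field_simp
    ring

lemma Ch.isoM {s t : Multiset k} (h : Ch s t) : IsoM s t := by
  induction h with
  | refl s => exact IsoM.refl s
  | symm _ ih => exact ih.symm
  | trans _ _ ih ih' => exact ih.trans ih'
  | sq a x u hx =>
    obtain ⟨d, hd⟩ := exists_rep u
    rw [← hd, ← ms_oc, ← ms_oc, isoM_iff]
    exact isoF_sq a x hx d
  | pair a b u _ _ h =>
    obtain ⟨d, hd⟩ := exists_rep u
    rw [← hd, ← ms_oc, ← ms_oc, ← ms_oc, ← ms_oc, isoM_iff]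
    exact isoF_pair a b h d

lemma Ch.card {s t : Multiset k} (h : Ch s t) : Multiset.card s = Multiset.card t := by
  induction h with
  | refl s => rfl
  | symm _ ih => exact ih.symm
  | trans _ _ ih ih' => exact ih.trans ih'
  | sq a x u hx => simp
  | pair a b u _ _ h => simp

lemma Ch.reg {s t : Multiset k} (h : Ch s t) : (0 : k) ∉ s ↔ (0 : k) ∉ t := by
  induction h with
  | refl s => rfl
  | symm _ ih => exact ih.symm
  | trans _ _ ih ih' => exact ih.trans ih'
  | sq a x u hx => simp [hx, eq_comm (a := (0 : k))]
  | pair a b u h1 h2 h => simp [h1, h2, h, eq_comm (a := (0 : k))]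

lemma Ch.map {F : Type} [Field F] (f : k →+* F) {s t : Multiset k} (h : Ch s t) :
    Ch (s.map f) (t.map f) := by
  induction h with
  | refl s => exact Ch.refl _
  | symm _ ih => exact ih.symm
  | trans _ _ ih ih' => exact ih.trans ih'
  | sq a x u hx =>
    simpa using Ch.sq (f a) (f x) (u.map f) (by simpa using hx)
  | pair a b u h1 h2 h =>
    simpa using Ch.pair (f a) (f b) (u.map f) (by simpa using h1) (by simpa using h2)
      (by rw [← map_add]; exact (map_ne_zero f).2 h)

lemma Ch.cons {s t : Multiset k} (c : k) (h : Ch s t) : Ch (c ::ₘ s) (c ::ₘ t) := by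
  induction h with
  | refl s => exact Ch.refl _
  | symm _ ih => exact ih.symm
  | trans _ _ ih ih' => exact ih.trans ih'
  | sq a x u hx =>
    rw [Multiset.cons_swap c, Multiset.cons_swap c]
    exact Ch.sq a x _ hx
  | pair a b u h1 h2 h =>
    rw [Multiset.cons_swap c, Multiset.cons_swap c b, Multiset.cons_swap c (a + b),
      Multiset.cons_swap c (a * b * (a + b))]
    exact Ch.pair a b _ h1 h2 h

lemma Ch.add_left {s t : Multiset k} (u : Multiset k) (h : Ch s t) : Ch (u + s) (u + t) := by
  induction u using Multiset.induction_on with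
  | empty => simpa using h
  | cons a u ih => simpa using ih.cons a

lemma Ch.add {s t s' t' : Multiset k} (h : Ch s t) (h' : Ch s' t') : Ch (s + s') (t + t') := by
  refine (h'.add_left s).trans ?_
  rw [add_comm s, add_comm t]
  exact h.add_left t'

lemma Ch.scale {s t : Multiset k} (c : k) (hc : c ≠ 0) (h : Ch s t) :
    Ch (s.map (c * ·)) (t.map (c * ·)) := by
  induction h with
  | refl s => exact Ch.refl _
  | symm _ ih => exact ih.symm
  | trans _ _ ih ih' => exact ih.trans ih'
  | sq a x u hx =>
    simpa [mul_assoc] using Ch.sq (c * a) x (u.map (c * ·)) hx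
  | pair a b u h1 h2 h =>
    have h3 := Ch.pair (c * a) (c * b) (u.map (c * ·)) (mul_ne_zero hc h1) (mul_ne_zero hc h2)
      (by rw [← mul_add]; exact mul_ne_zero hc h)
    have h4 := (Ch.sq (c * (a * b * (a + b))) c (u.map (c * ·)) hc).cons (c * (a + b))
    simp only [Multiset.map_cons]
    refine h3.trans ?_
    refine Ch.trans ?_ h4.symm
    have e1 : c * a + c * b = c * (a + b) := by ring
    have e2 : c * a * (c * b) * (c * a + c * b) = c * (a * b * (a + b)) * c ^ 2 := by ring
    rw [e2, e1]
    exact Ch.refl _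

end basics
end HS

namespace HS

open Finset

section met
variable {k : Type} [Field k] {ι κ : Type} [Fintype ι] [Fintype κ]

lemma exists_rep' {α : Type} (s : Multiset α) : ∃ (n : ℕ) (d : Fin n → α), ms d = s :=
  ⟨_, exists_rep s⟩

lemma val_zero (s : Multiset k) : Val s 0 := by
  obtain ⟨d, hd⟩ := exists_rep s
  exact ⟨_, d, hd, 0, Qd_zero d⟩

lemma val_cons (a : k) (s : Multiset k) (c : k) :
    Val (a ::ₘ s) c ↔ ∃ x v, Val s v ∧ a * x ^ 2 + v = c := by
  obtain ⟨d, hd⟩ := exists_rep s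
  rw [← hd, ← ms_oc, val_iff]
  constructor
  · rintro ⟨x, hx⟩
    rw [Qd_oc] at hx
    exact ⟨x none, _, (val_iff _ _).2 ⟨_, rfl⟩, hx⟩
  · rintro ⟨x, v, hv, h⟩
    obtain ⟨y, hy⟩ := (val_iff _ _).1 hv
    exact ⟨oc x y, by rw [Qd_oc, ← h, ← hy]; rfl⟩

lemma val_add (s t : Multiset k) (c : k) :
    Val (s + t) c ↔ ∃ v w, Val s v ∧ Val t w ∧ v + w = c := by
  obtain ⟨d, hd⟩ := exists_rep s
  obtain ⟨e, he⟩ := exists_rep t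
  rw [← hd, ← he, ← ms_sum, val_iff]
  constructor
  · rintro ⟨x, hx⟩
    rw [Qd_sum] at hx
    exact ⟨_, _, (val_iff _ _).2 ⟨_, rfl⟩, (val_iff _ _).2 ⟨_, rfl⟩, hx⟩
  · rintro ⟨v, w, hv, hw, h⟩
    obtain ⟨y, hy⟩ := (val_iff _ _).1 hv
    obtain ⟨z, hz⟩ := (val_iff _ _).1 hw
    exact ⟨Sum.elim y z, by rw [Qd_sum, ← h, ← hy, ← hz]; rfl⟩

lemma val_scale {s : Multiset k} {v : k} (c : k) (h : Val s v) : Val (s.map (c * ·)) (c * v) := by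
  obtain ⟨n, d, rfl, x, rfl⟩ := h
  rw [ms_map, val_iff]
  exact ⟨x, Qd_scale c d x⟩

lemma val_unscale {s : Multiset k} {v : k} (c : k) (hc : c ≠ 0) (h : Val (s.map (c * ·)) (c * v)) :
    Val s v := by
  have := val_scale c⁻¹ h
  simpa [Multiset.map_map, hc] using this

lemma val_sq {s : Multiset k} {v : k} (c : k) (h : Val s v) : Val s (c ^ 2 * v) := by
  obtain ⟨n, d, rfl, x, rfl⟩ := h
  rw [val_iff]
  exact ⟨c • x, Qd_smul d x c⟩

lemma isot_scale {s : Multiset k} (c : k) (h : Isot s) : Isot (s.map (c * ·)) := by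
  obtain ⟨n, d, rfl, x, hx, h⟩ := h
  rw [ms_map, isot_iff]
  exact ⟨x, hx, by have := Qd_scale c d x; rw [h, mul_zero] at this; exact this⟩

lemma isot_unscale {s : Multiset k} (c : k) (hc : c ≠ 0) (h : Isot (s.map (c * ·))) : Isot s := by
  have := isot_scale c⁻¹ h
  simpa [Multiset.map_map, hc] using this

lemma isot_add {s t : Multiset k} (h : Isot (s + t)) (hs : ¬ Isot s) (ht : ¬ Isot t) :
    ∃ v, v ≠ 0 ∧ Val s v ∧ Val t (-v) := by
  obtain ⟨_, d, rfl⟩ := exists_rep' s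
  obtain ⟨_, e, rfl⟩ := exists_rep' t
  rw [isot_iff] at hs ht
  rw [← ms_sum, isot_iff] at h
  obtain ⟨x, hx, h⟩ := h
  rw [Qd_sum] at h
  push Not at hs ht
  by_cases h0 : Qd d (fun i => x (Sum.inl i)) = 0
  · rw [h0, zero_add] at h
    exfalso
    have h1 : (fun i => x (Sum.inl i)) = 0 := by
      by_contra hne; exact hs _ hne h0
    have h2 : (fun i => x (Sum.inr i)) = 0 := by
      by_contra hne; exact ht _ hne h
    apply hx
    funext i
    rcases i with i | i
    · exact congrFun h1 i
    · exact congrFun h2 i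
  · refine ⟨_, h0, ?_, ?_⟩
    · rw [val_iff]; exact ⟨_, rfl⟩
    · rw [val_iff]; exact ⟨_, (neg_eq_of_add_eq_zero_right h).symm⟩

lemma isot_cons_of {a : k} {s : Multiset k} (h : Isot s) : Isot (a ::ₘ s) := by
  obtain ⟨n, d, rfl, x, hx, h⟩ := h
  rw [← ms_oc, isot_iff]
  refine ⟨oc 0 x, ?_, ?_⟩
  · intro h0; apply hx; funext i; exact congrFun h0 (some i)
  · rw [Qd_oc]; simpa using h

lemma isot_of_val_neg {a : k} {s : Multiset k} (h : Val s (-a)) : Isot (a ::ₘ s) := by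
  obtain ⟨n, d, rfl, x, h⟩ := h
  rw [← ms_oc, isot_iff]
  refine ⟨oc 1 x, ?_, ?_⟩
  · intro h0; simpa using congrFun h0 none
  · rw [Qd_oc]; simp only [oc_none, oc_some]; rw [h]; ring

lemma isot_cons {a : k} {s : Multiset k} (h : Isot (a ::ₘ s)) : Isot s ∨ Val s (-a) := by
  obtain ⟨d, hd⟩ := exists_rep s
  rw [← hd, ← ms_oc, isot_iff] at h
  obtain ⟨x, hx, h⟩ := h
  rw [Qd_oc] at h
  by_cases h0 : x none = 0
  · left
    rw [← hd, isot_iff]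
    refine ⟨fun i => x (some i), ?_, by simpa [h0] using h⟩
    intro h1; apply hx; funext o
    rcases o with _ | i
    · exact h0
    · exact congrFun h1 i
  · right
    rw [← hd, val_iff]
    refine ⟨(x none)⁻¹ • fun i => x (some i), ?_⟩
    rw [Qd_smul]
    have : Qd d (fun i => x (some i)) = - (a * x none ^ 2) := by linear_combination h
    rw [this]; field_simp

lemma ms_ne_zero {d : ι → k} (h : (0 : k) ∉ ms d) (i : ι) : d i ≠ 0 := by
  intro h0; apply h
  simp only [ms, Multiset.mem_map]
  exact ⟨i, Finset.mem_univ_val i, h0⟩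

lemma val_of_isot (h2 : (2 : k) ≠ 0) {s : Multiset k} (h : Isot s) (h0 : (0 : k) ∉ s) (c : k) :
    Val s c := by
  classical
  obtain ⟨n, d, rfl, x, hx, h⟩ := h
  obtain ⟨i, hi⟩ : ∃ i, x i ≠ 0 := by
    by_contra! hne; exact hx (funext hne)
  have hd := ms_ne_zero h0 i
  rw [val_iff]
  have hB : Bd d x (Pi.single i 1) = d i * x i := by
    simp [Bd, Pi.single_apply]
  have hQ : Qd d (Pi.single i 1) = d i := by
    simp [Qd, Pi.single_apply]
  refine ⟨((c - d i) / (2 * (d i * x i))) • x + Pi.single i 1, ?_⟩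
  rw [Qd_add, Qd_smul, Bd_smul_left, hB, hQ, h]
  field_simp
  ring

lemma rep {s : Multiset k} : ∀ {c : k}, Val s c → c ≠ 0 → (0 : k) ∉ s → ∃ s', Ch s (c ::ₘ s') := by
  induction s using Multiset.induction_on with
  | empty =>
    intro c h hc _
    obtain ⟨n, d, hd, x, hx⟩ := h
    exfalso
    have hn : n = 0 := by
      have := congrArg Multiset.card hd
      rw [ms_card] at this
      simpa using this
    subst hn
    exact hc (by rw [← hx]; simp [Qd])
  | cons a s ih =>
    intro c h hc h0
    obtain ⟨x, v, hv, h⟩ := (val_cons _ _ _).1 h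
    simp only [Multiset.mem_cons, not_or] at h0
    have ha : a ≠ 0 := Ne.symm h0.1
    by_cases hv0 : v = 0
    · subst hv0
      have hx : x ≠ 0 := by
        rintro rfl; apply hc; rw [← h]; ring
      refine ⟨s, ?_⟩
      have := Ch.sq a x s hx
      rwa [← h, add_zero]
    · obtain ⟨s', hs'⟩ := ih hv hv0 h0.2
      by_cases hx : x = 0
      · subst hx
        refine ⟨a ::ₘ s', ?_⟩
        have : c = v := by rw [← h]; ring
        subst this
        rw [Multiset.cons_swap]
        exact hs'.cons a
      · refine ⟨_, ((Ch.sq a x s hx).trans (hs'.cons _)).trans (?_ : Ch _ (c ::ₘ (a * x ^ 2 * v * c) ::ₘ s'))⟩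
        have := Ch.pair (a * x ^ 2) v s' (by positivity) hv0 (by rw [h]; exact hc)
        rwa [h] at this

lemma isot_split (h2 : (2 : k) ≠ 0) {s : Multiset k} (h : Isot s) (h0 : (0 : k) ∉ s) :
    ∃ s', Ch s (1 ::ₘ (-1) ::ₘ s') := by
  obtain ⟨s1, h1⟩ := rep (val_of_isot h2 h h0 1) one_ne_zero h0
  have h01 : (0 : k) ∉ s1 := by
    have := h1.reg.1 h0
    simp only [Multiset.mem_cons, not_or] at this
    exact this.2
  have : Val s1 (-1) := by
    rcases isot_cons (h1.isoM.isot h) with h3 | h3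
    · exact val_of_isot h2 h3 h01 _
    · exact h3
  obtain ⟨s2, h3⟩ := rep this (neg_ne_zero.2 one_ne_zero) h01
  exact ⟨s2, h1.trans (h3.cons 1)⟩

lemma met_isot {s t : Multiset k} (h : Met (s + t)) (hc : Multiset.card t < Multiset.card s) :
    Isot s := by
  obtain ⟨d, hd⟩ := exists_rep s
  obtain ⟨e, he⟩ := exists_rep t
  rw [← hd, ← he, ← ms_sum, met_iff] at h
  obtain ⟨L, hL, hQ⟩ := h
  let π : L →ₗ[k] (Fin (Multiset.card t) → k) :=
    (LinearMap.funLeft k k Sum.inr).comp L.subtype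
  have hlt : Module.finrank k (Fin (Multiset.card t) → k) < Module.finrank k L := by
    simp only [Module.finrank_pi, Fintype.card_fin, Fintype.card_sum] at hL ⊢
    omega
  obtain ⟨x, hx, hx0⟩ := (Submodule.ne_bot_iff _).1 (LinearMap.ker_ne_bot_of_finrank_lt (f := π) hlt)
  have hx1 : ∀ i, x.1 (Sum.inr i) = 0 := fun i => congrFun hx i
  rw [← hd, isot_iff]
  refine ⟨fun i => x.1 (Sum.inl i), ?_, ?_⟩
  · intro h0; apply hx0; apply Subtype.ext; funext i
    rcases i with i | i
    · exact congrFun h0 i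
    · exact hx1 i
  · have := hQ x.1 x.2
    rw [Qd_sum] at this
    simp only [hx1] at this
    have h3 : Qd e (fun _ => 0) = 0 := Qd_zero e
    rwa [h3, add_zero] at this

lemma met_zero : Met (0 : Multiset k) := ⟨0, Fin.elim0, rfl, ⊥, by simp, by simp [Qd]⟩

lemma met_scale {s : Multiset k} (c : k) (h : Met s) : Met (s.map (c * ·)) := by
  obtain ⟨n, d, rfl, L, hL, h⟩ := h
  rw [ms_map, met_iff]
  refine ⟨L, hL, fun x hx => ?_⟩
  have := Qd_scale c d x
  rw [h x hx, mul_zero] at this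
  exact this

lemma met_add {s t : Multiset k} (hs : Met s) (ht : Met t) : Met (s + t) := by
  obtain ⟨n, d, rfl, L, hL, h⟩ := hs
  obtain ⟨m, e, rfl, M, hM, h'⟩ := ht
  rw [← ms_sum, met_iff]
  let E := LinearEquiv.sumArrowLequivProdArrow (Fin n) (Fin m) k k
  let G : (L × M) →ₗ[k] (Fin n ⊕ Fin m → k) := (E.symm : _ →ₗ[k] _).comp
    (L.subtype.prodMap M.subtype)
  have hGl : ∀ x i, G x (Sum.inl i) = x.1.1 i := fun x i => rfl
  have hGr : ∀ x i, G x (Sum.inr i) = x.2.1 i := fun x i => rfl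
  refine ⟨LinearMap.range G, ?_, ?_⟩
  · have hinj : Function.Injective G := by
      intro x y hxy
      refine Prod.ext (Subtype.ext (funext fun i => ?_)) (Subtype.ext (funext fun i => ?_))
      · rw [← hGl x, hxy, hGl]
      · rw [← hGr x, hxy, hGr]
    rw [LinearMap.finrank_range_of_inj hinj, Module.finrank_prod, Fintype.card_sum]; omega
  · rintro _ ⟨x, rfl⟩
    rw [Qd_sum]
    simp only [hGl, hGr]
    rw [h _ x.1.2, h' _ x.2.2, add_zero]

lemma met_graph {d : ι → k} {e : κ → k} (h : IsoF d e) :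
    Met (ms d + (ms e).map Neg.neg) := by
  obtain ⟨P, hP⟩ := h
  rw [ms_map, ← ms_sum, met_iff]
  let E := LinearEquiv.sumArrowLequivProdArrow ι κ k k
  let G : (ι → k) →ₗ[k] (ι ⊕ κ → k) := (E.symm : _ →ₗ[k] _).comp
    (LinearMap.prod LinearMap.id (P : (ι → k) →ₗ[k] (κ → k)))
  have hGl : ∀ x i, G x (Sum.inl i) = x i := fun x i => rfl
  have hGr : ∀ x i, G x (Sum.inr i) = P x i := fun x i => rfl
  refine ⟨LinearMap.range G, ?_, ?_⟩
  · have hinj : Function.Injective G := by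
      intro x y hxy; funext i; rw [← hGl x, hxy, hGl]
    rw [LinearMap.finrank_range_of_inj hinj]
    have := P.finrank_eq
    simp only [Module.finrank_pi, Fintype.card_sum] at this ⊢
    omega
  · rintro _ ⟨x, rfl⟩
    rw [Qd_sum]
    simp only [hGl, hGr]
    have h1 := hP x
    have h2 : Qd (Neg.neg ∘ e) (fun i => P x i) = - Qd e (P x) := by simp [Qd]
    rw [h2, h1]; exact add_neg_cancel _

lemma met_self (s : Multiset k) : Met (s + s.map Neg.neg) := by
  obtain ⟨d, hd⟩ := exists_rep s
  rw [← hd]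
  exact met_graph (IsoF.refl d)

lemma Ch.met {s t : Multiset k} (h : Ch s t) (hs : Met s) : Met t := h.isoM.met hs

end met
end HS

namespace HS

open Finset

section met
variable {k : Type} [Field k] {ι κ : Type} [Fintype ι] [Fintype κ]

lemma finrank_map_inf {V W : Type} [AddCommGroup V] [Module k V] [AddCommGroup W] [Module k W]
    [FiniteDimensional k V] (L : Submodule k V) (p : V →ₗ[k] W) :
    Module.finrank k (L.map p) + Module.finrank k (L ⊓ LinearMap.ker p : Submodule k V)
      = Module.finrank k L := by
  have h := LinearMap.finrank_range_add_finrank_ker (p.domRestrict L)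
  rw [← h, LinearMap.range_domRestrict]
  congr 1
  have : (L ⊓ LinearMap.ker p : Submodule k V)
      = (LinearMap.ker (p.domRestrict L)).map L.subtype := by
    ext x; simp [Submodule.mem_map, and_comm]
  rw [this]
  exact ((Submodule.equivMapOfInjective L.subtype L.injective_subtype
    (LinearMap.ker (p.domRestrict L))).finrank_eq).symm

lemma metF_cancel (h2 : (2 : k) ≠ 0) {d : ι → k} (h : MetF (oc (1 : k) (oc (-1) d))) : MetF d := by
  obtain ⟨L, hL, hQ⟩ := h
  have hL' : Fintype.card ι + 2 ≤ 2 * Module.finrank k L := by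
    simp only [Fintype.card_option] at hL; omega
  obtain ⟨lam, hlam⟩ : ∃ lam : (Option (Option ι) → k) →ₗ[k] k,
      ∀ x, lam x = x none - x (some none) :=
    ⟨(LinearMap.proj none : (Option (Option ι) → k) →ₗ[k] k) - LinearMap.proj (some none),
      fun x => rfl⟩
  obtain ⟨π, hπ⟩ : ∃ π : (Option (Option ι) → k) →ₗ[k] (ι → k),
      ∀ x i, π x i = x (some (some i)) :=
    ⟨LinearMap.funLeft k k (fun i => some (some i)), fun x i => rfl⟩
  obtain ⟨ev, hev⟩ : ∃ ev : (Option (Option ι) → k) →ₗ[k] k, ∀ x, ev x = x none :=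
    ⟨LinearMap.proj none, fun x => rfl⟩
  obtain ⟨L1, hL1⟩ : ∃ L1 : Submodule k (Option (Option ι) → k), L1 = L ⊓ LinearMap.ker lam :=
    ⟨_, rfl⟩
  have hm : ∀ x ∈ L1, x ∈ L ∧ x none = x (some none) := by
    intro x hx
    rw [hL1, Submodule.mem_inf, LinearMap.mem_ker, hlam, sub_eq_zero] at hx
    exact hx
  have e1 := finrank_map_inf L lam
  rw [← hL1] at e1
  have e2 := finrank_map_inf L1 π
  have e3 := finrank_map_inf (L1 ⊓ LinearMap.ker π) ev
  have hb : L1 ⊓ LinearMap.ker π ⊓ LinearMap.ker ev = ⊥ := by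
    rw [Submodule.eq_bot_iff]
    intro x hx
    obtain ⟨⟨hx1, hx2⟩, hx3⟩ := hx
    have hx3 : x none = 0 := by rw [← hev x]; exact hx3
    funext o
    rcases o with _ | _ | i
    · exact hx3
    · rw [← (hm x hx1).2]; exact hx3
    · have h1 : π x i = 0 := congrFun hx2 i
      rw [hπ] at h1; exact h1
  rw [hb, finrank_bot, add_zero] at e3
  have b1 : ∀ M : Submodule k k, Module.finrank k M ≤ 1 := fun M => by
    have := Submodule.finrank_le M
    rwa [Module.finrank_self] at this
  have b2 := b1 ((L1 ⊓ LinearMap.ker π).map ev)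
  have b3 := b1 (L.map lam)
  refine ⟨L1.map π, ?_, ?_⟩
  · by_cases hk : (L1 ⊓ LinearMap.ker π : Submodule k (Option (Option ι) → k)) = ⊥
    · rw [hk, finrank_bot] at e2
      omega
    · obtain ⟨y, ⟨hy1, hy2⟩, hy0⟩ := (Submodule.ne_bot_iff _).1 hk
      have hyi : ∀ i, y (some (some i)) = 0 := fun i => by
        have h1 : π y i = 0 := congrFun hy2 i
        rwa [hπ] at h1
      have hyn : y none ≠ 0 := by
        intro h0
        apply hy0
        funext o
        rcases o with _ | _ | i
        · exact h0
        · rw [← (hm y hy1).2]; exact h0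
        · exact hyi i
      have hzero : L.map lam = ⊥ := by
        rw [Submodule.eq_bot_iff]
        rintro _ ⟨x, hx, rfl⟩
        have h1 := hQ _ (L.add_mem hx (hm y hy1).1)
        rw [Qd_add, hQ _ hx, hQ _ (hm y hy1).1] at h1
        have h3 : Bd (oc (1 : k) (oc (-1) d)) x y = 0 := by
          have : 2 * Bd (oc (1 : k) (oc (-1) d)) x y = 0 := by linear_combination h1
          exact (mul_eq_zero.1 this).resolve_left h2
        simp only [Bd, Fintype.sum_option, oc_none, oc_some, hyi, mul_zero, Finset.sum_const_zero,
          ← (hm y hy1).2] at h3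
        have h4 : (x none - x (some none)) * y none = 0 := by linear_combination h3
        rw [hlam]
        exact (mul_eq_zero.1 h4).resolve_right hyn
      rw [hzero, finrank_bot] at e1
      omega
  · rintro _ ⟨x, hx, rfl⟩
    have h1 := hQ _ (hm x hx).1
    rw [Qd_oc, Qd_oc, ← (hm x hx).2] at h1
    have : Qd d (fun i => x (some (some i))) = 0 := by linear_combination h1
    have e : π x = fun i => x (some (some i)) := funext (hπ x)
    rw [e]; exact this

lemma met_cancel_pair (h2 : (2 : k) ≠ 0) {s : Multiset k} (h : Met (1 ::ₘ (-1) ::ₘ s)) : Met s := by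
  obtain ⟨_, d, rfl⟩ := exists_rep' s
  rw [← ms_oc, ← ms_oc, met_iff] at h
  rw [met_iff]
  exact metF_cancel h2 h

lemma met_pair : Met ({1, -1} : Multiset k) := by
  have := met_self ({1} : Multiset k)
  simpa using this

lemma met_nsmul (m : ℕ) : Met (m • ({1, -1} : Multiset k)) := by
  induction m with
  | zero => simpa using met_zero
  | succ m ih => rw [succ_nsmul]; exact met_add ih met_pair

lemma pair_add (s : Multiset k) : (1 : k) ::ₘ (-1) ::ₘ s = s + {1, -1} := by
  rw [add_comm]
  simp

lemma met_chain (h2 : (2 : k) ≠ 0) (N : ℕ) : ∀ s : Multiset k, Multiset.card s = N → Met s →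
    (0 : k) ∉ s → ∃ m : ℕ, Ch s (m • ({1, -1} : Multiset k)) := by
  induction N using Nat.strong_induction_on with
  | _ N ih =>
    intro s hs hm h0
    rcases Nat.eq_zero_or_pos N with hN | hN
    · rw [hN, Multiset.card_eq_zero] at hs
      subst hs
      exact ⟨0, by rw [zero_nsmul]; exact Ch.refl _⟩
    · have hi : Isot s := met_isot (t := 0) (by simpa using hm) (by simpa [hs] using hN)
      obtain ⟨s', hs'⟩ := isot_split h2 hi h0
      have hc := hs'.card
      simp only [Multiset.card_cons] at hc
      have h0' := hs'.reg.1 h0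
      simp only [Multiset.mem_cons, not_or] at h0'
      obtain ⟨m, hm'⟩ := ih (Multiset.card s') (by omega) s' rfl
        (met_cancel_pair h2 (hs'.met hm)) h0'.2.2
      refine ⟨m + 1, hs'.trans ?_⟩
      rw [succ_nsmul, pair_add]
      exact hm'.add (Ch.refl _)

lemma met_map (h2 : (2 : k) ≠ 0) {F : Type} [Field F] (f : k →+* F) {s : Multiset k} (h : Met s)
    (h0 : (0 : k) ∉ s) : Met (s.map f) := by
  obtain ⟨m, hm⟩ := met_chain h2 _ s rfl h h0
  refine (hm.map f).symm.met ?_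
  rw [Multiset.map_nsmul]
  simpa using met_nsmul (k := F) m

lemma met_cancel (h2 : (2 : k) ≠ 0) {s t : Multiset k} (h : Met (s + t)) (ht : Met t)
    (h0 : (0 : k) ∉ t) : Met s := by
  obtain ⟨m, hm⟩ := met_chain h2 _ t rfl ht h0
  have h1 := (hm.add_left s).met h
  clear hm h ht h0
  induction m with
  | zero => simpa using h1
  | succ m ih =>
    rw [succ_nsmul, ← add_assoc, ← pair_add] at h1
    exact ih (met_cancel_pair h2 h1)

/-- Final step : Witt equivalent of the same dimension implies isometric. -/
lemma ch_of_met (h2 : (2 : k) ≠ 0) (s : Multiset k) : ∀ t : Multiset k,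
    Multiset.card s = Multiset.card t → (0 : k) ∉ s → (0 : k) ∉ t →
    Met (s + t.map Neg.neg) → Ch s t := by
  induction s using Multiset.induction_on with
  | empty =>
    intro t hc _ _ _
    rw [Multiset.card_zero, eq_comm, Multiset.card_eq_zero] at hc
    rw [hc]; exact Ch.refl _
  | cons a s ih =>
    intro t hc hs ht hm
    simp only [Multiset.mem_cons, not_or] at hs
    have hi : Isot (a ::ₘ t.map Neg.neg) := by
      refine met_isot (t := s) ?_ ?_
      · have : a ::ₘ t.map Neg.neg + s = a ::ₘ s + t.map Neg.neg := by
          rw [Multiset.cons_add, Multiset.cons_add, add_comm]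
        rw [this]; exact hm
      · simp only [Multiset.card_cons, Multiset.card_map] at hc ⊢
        omega
    have hneg : t.map Neg.neg = t.map ((-1) * ·) := by simp [neg_one_mul]
    have hv : Val t a := by
      rw [hneg] at hi
      rcases isot_cons hi with h | h
      · exact val_of_isot h2 (isot_unscale (-1) (by simp) h) ht _
      · exact val_unscale (-1) (by simp) (by simpa using h)
    obtain ⟨t', ht'⟩ := rep hv (Ne.symm hs.1) ht
    have hc' := ht'.card
    simp only [Multiset.card_cons] at hc hc'
    have h0' := ht'.reg.1 ht
    simp only [Multiset.mem_cons, not_or] at h0'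
    refine Ch.trans (Ch.cons a (ih t' (by omega) hs.2 h0'.2 ?_)) ht'.symm
    have h3 : Ch (t.map Neg.neg) ((a ::ₘ t').map Neg.neg) := by
      have := ht'.scale (-1) (by simp)
      simpa [neg_one_mul] using this
    have h4 := (h3.add_left (a ::ₘ s)).met hm
    refine met_cancel h2 (t := {a} + ({a} : Multiset k).map Neg.neg) ?_ (met_self _) ?_
    · have : s + t'.map Neg.neg + ({a} + ({a} : Multiset k).map Neg.neg)
        = a ::ₘ s + (a ::ₘ t').map Neg.neg := by
        simp only [← Multiset.singleton_add, Multiset.map_add]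
        abel
      rw [this]; exact h4
    · simp [hs.1, eq_comm (a := (0 : k)), Ne.symm hs.1]

end met
end HS

namespace HS

section pfister
variable {k : Type} [Field k]

/-- Pfister form -/
def pf (l : Multiset k) : Multiset k := l.powerset.map Multiset.prod

lemma pf_zero : pf (0 : Multiset k) = {1} := by simp [pf]

lemma pf_cons (a : k) (l : Multiset k) : pf (a ::ₘ l) = pf l + (pf l).map (a * ·) := by
  simp [pf, Multiset.powerset_cons, Multiset.map_map, Function.comp_def]

lemma pf_card (l : Multiset k) : Multiset.card (pf l) = 2 ^ Multiset.card l := by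
  simp [pf]

lemma zero_notMem_scale {s : Multiset k} {c : k} (hc : c ≠ 0) (h : (0 : k) ∉ s) :
    (0 : k) ∉ s.map (c * ·) := by
  simp only [Multiset.mem_map, not_exists, not_and]
  rintro x hx h0
  rcases mul_eq_zero.1 h0 with h1 | h1
  · exact hc h1
  · exact h (h1 ▸ hx)

lemma zero_notMem_map {F : Type} [Field F] (f : k →+* F) {s : Multiset k} (h : (0 : k) ∉ s) :
    (0 : F) ∉ s.map f := by
  simp only [Multiset.mem_map, not_exists, not_and]
  rintro x hx h0
  rw [map_eq_zero] at h0
  exact h (h0 ▸ hx)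

lemma pf_reg {l : Multiset k} (h : (0 : k) ∉ l) : (0 : k) ∉ pf l := by
  induction l using Multiset.induction_on with
  | empty => simp [pf]
  | cons a l ih =>
    simp only [Multiset.mem_cons, not_or] at h
    rw [pf_cons, Multiset.mem_add, not_or]
    exact ⟨ih h.2, zero_notMem_scale (Ne.symm h.1) (ih h.2)⟩

lemma pf_map {F : Type} [Field F] (f : k →+* F) (l : Multiset k) :
    (pf l).map f = pf (l.map f) := by
  induction l using Multiset.induction_on with
  | empty => simp [pf]
  | cons a l ih =>
    rw [Multiset.map_cons, pf_cons, pf_cons, Multiset.map_add, ← ih]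
    simp [Multiset.map_map, Function.comp_def]

lemma pf_one (l : Multiset k) : ∃ s, pf l = 1 ::ₘ s := by
  induction l using Multiset.induction_on with
  | empty => exact ⟨0, by simp [pf]⟩
  | cons a l ih =>
    obtain ⟨s, hs⟩ := ih
    exact ⟨s + (pf l).map (a * ·), by rw [pf_cons]; nth_rewrite 1 [hs]; rw [Multiset.cons_add]⟩

lemma map_mul_mul (P : Multiset k) (x y : k) :
    (P.map (x * ·)).map (y * ·) = P.map (y * x * ·) := by
  simp [Multiset.map_map, Function.comp_def, mul_assoc]

lemma ch_sq_scale {P : Multiset k} {x : k} (hx : x ≠ 0) : Ch P (P.map (x ^ 2 * ·)) := by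
  induction P using Multiset.induction_on with
  | empty => exact Ch.refl _
  | cons p P ih =>
    rw [Multiset.map_cons, mul_comm]
    exact (Ch.sq p x P hx).trans (ih.cons _)

lemma ch_add_scale {P : Multiset k} (h0 : (0 : k) ∉ P) {x y : k} (hx : x ≠ 0) (hy : y ≠ 0)
    (hxy : x + y ≠ 0) : Ch (P.map (x * ·) + P.map (y * ·))
      (P.map ((x + y) * ·) + P.map ((x * y * (x + y)) * ·)) := by
  induction P using Multiset.induction_on with
  | empty => exact Ch.refl _
  | cons p P ih =>
    simp only [Multiset.mem_cons, not_or] at h0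
    have hp : p ≠ 0 := Ne.symm h0.1
    simp only [Multiset.map_cons, Multiset.cons_add, Multiset.add_cons]
    have h1 := Ch.pair (x * p) (y * p) (P.map (x * ·) + P.map (y * ·)) (mul_ne_zero hx hp)
      (mul_ne_zero hy hp) (by rw [← add_mul]; exact mul_ne_zero hxy hp)
    rw [Multiset.cons_swap, Multiset.cons_swap (x * y * (x + y) * p)]
    refine h1.trans ?_
    rw [← add_mul]
    refine Ch.cons _ ?_
    have h3 := Ch.sq (x * p * (y * p) * ((x + y) * p)) p⁻¹ (P.map (x * ·) + P.map (y * ·))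
      (inv_ne_zero hp)
    have e : x * p * (y * p) * ((x + y) * p) * p⁻¹ ^ 2 = x * y * (x + y) * p := by
      field_simp
    rw [e] at h3
    exact h3.trans ((ih h0.2).cons _)

lemma round {l : Multiset k} (h0 : (0 : k) ∉ l) : ∀ {v : k}, Val (pf l) v → v ≠ 0 →
    Ch (pf l) ((pf l).map (v * ·)) := by
  induction l using Multiset.induction_on with
  | empty =>
    intro v hv hv0
    rw [pf_zero, ← Multiset.cons_zero, val_cons] at hv
    obtain ⟨x, w, hw, e⟩ := hv
    have hw0 : w = 0 := by
      obtain ⟨n, d, hd, y, hy⟩ := hw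
      have : n = 0 := by have := ms_card d; rw [hd] at this; simpa using this.symm
      subst this
      rw [← hy]; simp [Qd]
    rw [hw0, add_zero, one_mul] at e
    subst e
    exact ch_sq_scale (by rintro rfl; simp at hv0)
  | cons a l ih =>
    intro c hc hc0
    simp only [Multiset.mem_cons, not_or] at h0
    have ha : a ≠ 0 := Ne.symm h0.1
    replace ih : ∀ {v : k}, Val (pf l) v → v ≠ 0 → Ch (pf l) ((pf l).map (v * ·)) :=
      fun hv => ih h0.2 hv
    have hP := pf_reg h0.2
    rw [pf_cons, val_add] at hc
    obtain ⟨v, w', hv, hw', rfl⟩ := hc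
    obtain ⟨w, rfl⟩ : ∃ w, w' = a * w := ⟨a⁻¹ * w', by field_simp⟩
    have hw := val_unscale a ha hw'
    rw [pf_cons, Multiset.map_add, map_mul_mul]
    generalize pf l = P at *
    by_cases hv0 : v = 0
    · subst hv0
      rw [zero_add] at hc0 ⊢
      have hw0 : w ≠ 0 := right_ne_zero_of_mul hc0
      have h1 : Ch P (P.map (a * w * a * ·)) := by
        have h := (ih hw hw0).trans ((ch_sq_scale (P := P.map (w * ·)) ha))
        rw [map_mul_mul] at h
        have e : a * w * a = a ^ 2 * w := by ring
        rw [e]; exact h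
      have h3 : Ch (P.map (a * ·)) (P.map (a * w * ·)) := by
        have h := (ih hw hw0).scale a ha
        rwa [map_mul_mul] at h
      rw [add_comm]
      exact h3.add h1
    · by_cases hw0 : w = 0
      · subst hw0
        rw [mul_zero, add_zero] at hc0 ⊢
        refine (ih hv hv0).add ?_
        have h := (ih hv hv0).scale a ha
        rw [map_mul_mul] at h
        rw [mul_comm v a]; exact h
      · have h1 : Ch (P + P.map (a * ·)) (P.map (v * ·) + P.map (a * w * ·)) := by
          refine (ih hv hv0).add ?_
          have h := (ih hw hw0).scale a ha
          rwa [map_mul_mul] at h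
        refine (h1.trans (ch_add_scale hP hv0 (mul_ne_zero ha hw0) hc0)).trans ?_
        refine Ch.add_left _ ?_
        have h3 : Ch P (P.map (w * v * ·)) := by
          have h := (ih hv hv0).scale w hw0
          rw [map_mul_mul] at h
          exact (ih hw hw0).trans h
        have h4 := h3.scale ((v + a * w) * a) (mul_ne_zero hc0 ha)
        rw [map_mul_mul] at h4
        have e : v * (a * w) * (v + a * w) = (v + a * w) * a * (w * v) := by ring
        rw [e]; exact h4.symm

lemma pf_met {l : Multiset k} (h0 : (0 : k) ∉ l) (h : Isot (pf l)) : Met (pf l) := by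
  induction l using Multiset.induction_on with
  | empty =>
    exfalso
    rw [pf_zero] at h
    obtain ⟨n, d, hd, x, hx, hq⟩ := h
    have hn : n = 1 := by have := ms_card d; rw [hd] at this; simpa using this.symm
    subst hn
    have hd0 : d 0 = 1 := by simpa [ms] using hd
    apply hx
    funext i
    have : i = 0 := Subsingleton.elim _ _
    subst this
    simpa [Qd, hd0] using hq
  | cons a l ih =>
    simp only [Multiset.mem_cons, not_or] at h0
    have ha : a ≠ 0 := Ne.symm h0.1
    rw [pf_cons] at h ⊢
    by_cases h1 : Isot (pf l)
    · exact met_add (ih h0.2 h1) (met_scale a (ih h0.2 h1))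
    · obtain ⟨v, hv0, hv, hv'⟩ := isot_add h h1 (fun h => h1 (isot_unscale a ha h))
      obtain ⟨w, hw⟩ : ∃ w, -v = a * w := ⟨a⁻¹ * -v, by field_simp⟩
      rw [hw] at hv'
      have hw' := val_unscale a ha hv'
      have hw0 : w ≠ 0 := by
        rintro rfl
        rw [mul_zero, neg_eq_zero] at hw
        exact hv0 hw
      have c1 := round h0.2 hv hv0
      have c2 := (round h0.2 hw' hw0).scale a ha
      rw [map_mul_mul, ← hw] at c2
      refine (c1.add c2).symm.met ?_
      have := met_self ((pf l).map (v * ·))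
      simpa [Multiset.map_map, Function.comp_def] using this

end pfister
end HS

namespace HS

section cp
open Polynomial
variable {E : Type} [Field E] {ι : Type} [Fintype ι]

/-- anisotropic -/
def An {R : Type} [CommRing R] (d : ι → R) : Prop := ∀ x, Qd d x = 0 → x = 0

lemma an_iff (d : ι → E) : ¬ Isot (ms d) ↔ An d := by
  rw [isot_iff]
  constructor
  · intro h x hx
    by_contra h0
    exact h ⟨x, h0, hx⟩
  · rintro h ⟨x, h0, hx⟩
    exact h0 (h x hx)

lemma Qd_coeff (d : ι → E) (h : ι → E[X]) (D : ℕ) (hD : ∀ i, (h i).natDegree ≤ D) :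
    (Qd (C ∘ d) h).coeff (2 * D) = Qd d (fun i => (h i).coeff D) := by
  simp only [Qd, finset_sum_coeff, Function.comp_apply, coeff_C_mul]
  refine Finset.sum_congr rfl fun i _ => ?_
  rw [coeff_pow_of_natDegree_le (hD i)]

lemma deg_le {d : ι → E} (hd : An d) (h : ι → E[X]) (M : ℕ)
    (hM : (Qd (C ∘ d) h).natDegree ≤ 2 * M) (i : ι) : (h i).natDegree ≤ M := by
  by_contra hlt
  push Not at hlt
  obtain ⟨j, -, hj⟩ := Finset.exists_max_image Finset.univ (fun i => (h i).natDegree)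
    ⟨i, Finset.mem_univ i⟩
  have h1 := Qd_coeff d h (h j).natDegree (fun i => hj i (Finset.mem_univ i))
  have h3 := hj i (Finset.mem_univ i)
  rw [coeff_eq_zero_of_natDegree_lt (by omega)] at h1
  have h4 := congrFun (hd _ h1.symm) j
  simp only [Pi.zero_apply, coeff_natDegree, leadingCoeff_eq_zero] at h4
  rw [h4, natDegree_zero] at h3
  omega

lemma an_poly {d : ι → E} (hd : An d) : An (C ∘ d : ι → E[X]) := by
  intro h h0
  have h1 : ∀ i, (h i).natDegree ≤ 0 := deg_le hd h 0 (by rw [h0]; simp)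
  have h3 := Qd_coeff d h 0 h1
  rw [h0, coeff_zero] at h3
  have h4 := hd _ h3.symm
  funext i
  rw [eq_C_of_natDegree_le_zero (h1 i)]
  have := congrFun h4 i
  simp only [Pi.zero_apply] at this
  rw [this]; simp

lemma cp_poly {d : ι → E} (hd : An d) (p : E[X]) (N : ℕ) : ∀ (f : ι → E[X]) (g : E[X]),
    g.natDegree = N → g ≠ 0 → Qd (C ∘ d) f = g ^ 2 * p → ∃ h : ι → E[X], Qd (C ∘ d) h = p := by
  induction N using Nat.strong_induction_on with
  | _ N ih =>
    intro f g hN hg hf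
    obtain ⟨h, hh⟩ : ∃ h : ι → E[X], ∀ i, h i = f i / g := ⟨_, fun i => rfl⟩
    obtain ⟨r, hr⟩ : ∃ r : ι → E[X], ∀ i, r i = f i % g := ⟨_, fun i => rfl⟩
    have hfe : f = g • h + r := by
      funext i
      simp only [Pi.add_apply, Pi.smul_apply, smul_eq_mul, hh, hr, EuclideanDomain.div_add_mod]
    have hQ := hf
    rw [hfe, Qd_add, Qd_smul, Bd_smul_left] at hQ
    by_cases hr0 : Qd (C ∘ d) r = 0
    · have hr1 := an_poly hd r hr0
      refine ⟨h, mul_left_cancel₀ (pow_ne_zero 2 hg) ?_⟩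
      have hB : Bd (C ∘ d : ι → E[X]) h r = 0 := by rw [hr1]; simp [Bd]
      rw [hr0, hB] at hQ
      linear_combination hQ
    · obtain ⟨g', hg'⟩ : ∃ g', g' = g * (p - Qd (C ∘ d) h) - 2 * Bd (C ∘ d) h r := ⟨_, rfl⟩
      have hr2 : Qd (C ∘ d) r = g * g' := by rw [hg']; linear_combination hQ
      have hg'0 : g' ≠ 0 := by
        rintro h0; rw [h0, mul_zero] at hr2; exact hr0 hr2
      have hrd : ∀ i, (r i).natDegree ≤ g.natDegree - 1 := by
        intro i
        by_cases h0 : r i = 0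
        · rw [h0]; simp
        · have := degree_mod_lt (f i) hg
          rw [← hr] at this
          have := natDegree_lt_natDegree h0 this
          omega
      have hgpos : 0 < g.natDegree := by
        by_contra hz
        push Not at hz
        apply hr0
        have : r = 0 := by
          funext i
          by_contra h0
          have := degree_mod_lt (f i) hg
          rw [← hr] at this
          have := natDegree_lt_natDegree h0 this
          omega
        rw [this]; simp [Qd]
      have hdeg : (Qd (C ∘ d) r).natDegree ≤ 2 * (g.natDegree - 1) := by
        refine natDegree_sum_le_of_forall_le _ _ fun i _ => ?_
        refine (natDegree_C_mul_le _ _).trans ?_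
        exact natDegree_pow_le_of_le 2 (hrd i)
      rw [hr2, natDegree_mul hg hg'0] at hdeg
      refine ih g'.natDegree (by omega) (g' • h + (Qd (C ∘ d) h - p) • r) g' rfl hg'0 ?_
      rw [Qd_add, Qd_smul, Qd_smul, Bd_smul_left, Bd_smul_right, hr2]
      rw [hg']
      ring

/-- the embedding -/
noncomputable def emb (E : Type) [Field E] : E →+* FractionRing E[X] :=
  (algebraMap E[X] (FractionRing E[X])).comp C

lemma clear_den (y : ι → FractionRing E[X]) : ∃ (g : E[X]) (f : ι → E[X]), g ≠ 0 ∧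
    (algebraMap E[X] (FractionRing E[X])) ∘ f = algebraMap E[X] (FractionRing E[X]) g • y := by
  obtain ⟨b, hb⟩ := IsLocalization.exist_integer_multiples_of_finite (nonZeroDivisors E[X]) y
  choose f hf using hb
  refine ⟨b, f, nonZeroDivisors.ne_zero b.2, ?_⟩
  funext i
  simp only [Function.comp_apply, hf, Pi.smul_apply]
  rw [Algebra.smul_def]; rfl

lemma emb_comp (d : ι → E) : emb E ∘ d = algebraMap E[X] (FractionRing E[X]) ∘ (C ∘ d) := rfl

lemma algMap_inj : Function.Injective (algebraMap E[X] (FractionRing E[X])) :=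
  IsFractionRing.injective _ _

lemma an_emb {d : ι → E} (hd : An d) : An (emb E ∘ d) := by
  intro y hy
  obtain ⟨g, f, hg, hf⟩ := clear_den y
  have hg' : algebraMap E[X] (FractionRing E[X]) g ≠ 0 := by
    rw [Ne, map_eq_zero_iff _ algMap_inj]; exact hg
  have h1 : Qd (emb E ∘ d) (algebraMap E[X] (FractionRing E[X]) ∘ f) = 0 := by
    rw [hf, Qd_smul, hy, mul_zero]
  rw [emb_comp, Qd_map, map_eq_zero_iff _ algMap_inj] at h1
  have h3 := an_poly hd f h1
  funext i
  have h4 := congrFun hf i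
  rw [h3] at h4
  simp only [Function.comp_apply, Pi.zero_apply, map_zero, Pi.smul_apply, smul_eq_mul] at h4
  exact (mul_eq_zero.1 h4.symm).resolve_left hg'

lemma cp_frac {d : ι → E} (hd : An d) (p : E[X]) (y : ι → FractionRing E[X])
    (hy : Qd (emb E ∘ d) y = algebraMap E[X] (FractionRing E[X]) p) :
    ∃ h : ι → E[X], Qd (C ∘ d) h = p := by
  obtain ⟨g, f, hg, hf⟩ := clear_den y
  refine cp_poly hd p _ f g rfl hg ?_
  apply algMap_inj
  rw [← Qd_map, ← emb_comp, hf, Qd_smul, hy, map_mul, map_pow]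

lemma Qd_eval (d : ι → E) (h : ι → E[X]) (t : E) :
    Qd d (fun i => (h i).eval t) = (Qd (C ∘ d) h).eval t := by
  have := Qd_map (evalRingHom t) (C ∘ d) h
  simp only [coe_evalRingHom] at this
  rw [← this]
  simp [Qd]

lemma cp_const {d : ι → E} (hd : An d) (c : E) (y : ι → FractionRing E[X])
    (hy : Qd (emb E ∘ d) y = emb E c) : ∃ x, Qd d x = c := by
  obtain ⟨h, hh⟩ := cp_frac hd (C c) y hy
  refine ⟨fun i => (h i).eval 0, ?_⟩
  rw [Qd_eval, hh, eval_C]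

lemma cp_quad (h2 : (2 : E) ≠ 0) {d : ι → E} (hd : An d) (a b : E) (y : ι → FractionRing E[X])
    (hy : Qd (emb E ∘ d) y = emb E a * algebraMap E[X] (FractionRing E[X]) X ^ 2 + emb E b) :
    ∃ u v, Qd d u = a ∧ Qd d v = b ∧ Bd d u v = 0 := by
  obtain ⟨h, hh⟩ := cp_frac hd (C a * X ^ 2 + C b) y (by rw [hy]; simp [emb])
  have hdeg : ∀ i, (h i).natDegree ≤ 1 := by
    refine deg_le hd h 1 ?_
    rw [hh]
    compute_degree
  have h0 : ∀ i, (h i).coeff 0 = (h i).eval 0 := fun i => by rw [coeff_zero_eq_eval_zero]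
  have hu : Qd d (fun i => (h i).coeff 1) = a := by
    rw [← Qd_coeff d h 1 hdeg, hh]
    simp [coeff_C]
  have hv : Qd d (fun i => (h i).coeff 0) = b := by
    simp only [h0]
    rw [Qd_eval, hh]; simp
  refine ⟨_, _, hu, hv, ?_⟩
  have h1 : Qd d (fun i => (h i).eval 1) = a + b := by
    rw [Qd_eval, hh]; simp
  have e : (fun i => (h i).eval 1) = (fun i => (h i).coeff 1) + (fun i => (h i).coeff 0) := by
    funext i
    rw [eq_X_add_C_of_natDegree_le_one (hdeg i)]
    simp
  rw [e, Qd_add, hu, hv] at h1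
  have : 2 * Bd d (fun i => (h i).coeff 1) (fun i => (h i).coeff 0) = 0 := by linear_combination h1
  exact (mul_eq_zero.1 this).resolve_left h2

end cp
end HS

namespace HS

section tower
open Polynomial
variable {k : Type} [Field k]

lemma val_map {F : Type} [Field F] (f : k →+* F) {s : Multiset k} {c : k} (h : Val s c) :
    Val (s.map f) (f c) := by
  obtain ⟨n, d, rfl, x, rfl⟩ := h
  rw [ms_map, val_iff]
  exact ⟨f ∘ x, Qd_map f d x⟩

lemma reg_of_not_isot {s : Multiset k} (h : ¬ Isot s) : (0 : k) ∉ s := by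
  intro h0
  obtain ⟨t, rfl⟩ := Multiset.exists_cons_of_mem h0
  exact h (isot_of_val_neg (by rw [neg_zero]; exact val_zero t))

lemma reflect {ι : Type} [Fintype ι] {A b : k} (hA : A ≠ 0) {d : ι → k} (hd : An d)
    (x y : Option ι → k) (hx : Qd (oc A d) x = A) (hy : Qd (oc A d) y = b)
    (hxy : Bd (oc A d) x y = 0) : ∃ z, Qd d z = b := by
  have hB : A * x none * y none + Bd d (fun i => x (some i)) (fun i => y (some i)) = 0 := by
    rw [← hxy]; simp [Bd, Fintype.sum_option]
  rw [Qd_oc] at hx hy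
  by_cases h1 : x none = 1
  · rw [h1] at hx hB
    have hx0 := hd _ (by linear_combination hx : Qd d (fun i => x (some i)) = 0)
    have hB0 : Bd d (fun i => x (some i)) (fun i => y (some i)) = 0 := by
      rw [hx0]; simp [Bd]
    rw [hB0, mul_one, add_zero] at hB
    have hy0 := (mul_eq_zero.1 hB).resolve_left hA
    exact ⟨_, by rw [hy0] at hy; linear_combination hy⟩
  · have h1' : 1 - x none ≠ 0 := fun h => h1 (by linear_combination -h)
    obtain ⟨L, hL⟩ : ∃ L, L * (1 - x none) = y none := ⟨y none / (1 - x none), by field_simp⟩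
    refine ⟨L • (fun i => x (some i)) + (fun i => y (some i)), ?_⟩
    rw [Qd_add, Qd_smul, Bd_smul_left]
    linear_combination hy + L ^ 2 * hx + 2 * L * hB +
      (L * A * (1 + x none) + A * y none) * hL

lemma tower (h2 : (2 : k) ≠ 0) (l : Multiset k) (hl : (0 : k) ∉ l) :
    ∃ (F : Type) (_ : Field F) (f : k →+* F) (b : F), Val (l.map f) b ∧
      (∀ s : Multiset k, ¬ Isot s → ¬ Isot (s.map f)) ∧
      (∀ (s : Multiset k) (c : k), ¬ Isot s → Val (s.map f) (f c) → Val s c) ∧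
      (∀ s : Multiset k, ¬ Isot s → Val (s.map f) b → Multiset.card l ≤ Multiset.card s) := by
  induction l using Multiset.induction_on with
  | empty =>
    refine ⟨k, inferInstance, RingHom.id k, 0, val_zero _, ?_, ?_, ?_⟩
    · intro s hs; simpa using hs
    · intro s c _ h; simpa using h
    · intro s _ _; simp
  | cons a l ih =>
    simp only [Multiset.mem_cons, not_or] at hl
    have ha : a ≠ 0 := Ne.symm hl.1
    obtain ⟨F, _, f, b, hb, H1, H3, H2⟩ := ih hl.2
    have h2F : (2 : F) ≠ 0 := by
      have : f 2 ≠ 0 := by rwa [Ne, map_eq_zero]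
      rwa [map_ofNat] at this
    refine ⟨FractionRing F[X], inferInstance, (emb F).comp f,
      emb F (f a) * algebraMap F[X] (FractionRing F[X]) X ^ 2 + emb F b, ?_, ?_, ?_, ?_⟩
    · rw [Multiset.map_cons, val_cons]
      refine ⟨_, _, ?_, rfl⟩
      have := val_map (emb F) hb
      rwa [Multiset.map_map] at this
    · intro s hs
      have h := H1 s hs
      obtain ⟨n, e, rfl⟩ := exists_rep' s
      rw [ms_map, an_iff] at h ⊢
      exact an_emb h
    · intro s c hs hv
      have h := H1 s hs
      refine H3 s c hs ?_
      obtain ⟨n, e, rfl⟩ := exists_rep' s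
      rw [ms_map, an_iff] at h
      rw [ms_map, val_iff] at hv ⊢
      obtain ⟨y, hy⟩ := hv
      exact cp_const h (f c) y hy
    · intro s hs hv
      obtain ⟨n, e, rfl, u, v, hu, hv, huv⟩ : ∃ (n : ℕ) (e : Fin n → k), ms e = s ∧ ∃ u v,
          Qd (f ∘ e) u = f a ∧ Qd (f ∘ e) v = b ∧ Bd (f ∘ e) u v = 0 := by
        have h := H1 s hs
        obtain ⟨n, e, rfl⟩ := exists_rep' s
        rw [ms_map, an_iff] at h
        rw [ms_map, val_iff] at hv
        obtain ⟨y, hy⟩ := hv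
        exact ⟨n, e, rfl, cp_quad h2F h (f a) b y hy⟩
      have hva : Val (ms e) a := H3 _ a hs (by rw [ms_map, val_iff]; exact ⟨u, hu⟩)
      obtain ⟨s', hs'⟩ := rep hva ha (reg_of_not_isot hs)
      have hs'i : ¬ Isot s' := fun h => hs (hs'.isoM.symm.isot (isot_cons_of h))
      have hcard := hs'.card
      have hiso := (hs'.map f).isoM
      have hA := H1 s' hs'i
      obtain ⟨n', e', rfl⟩ := exists_rep' s'
      rw [Multiset.map_cons, ms_map, ms_map, ← ms_oc, isoM_iff] at hiso
      rw [ms_map, an_iff] at hA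
      obtain ⟨P, hP⟩ := hiso
      have hB : Bd (oc (f a) (f ∘ e')) (P u) (P v) = 0 := by
        have h1 := hP (u + v)
        rw [map_add, Qd_add, Qd_add, hP, hP, huv] at h1
        have : 2 * Bd (oc (f a) (f ∘ e')) (P u) (P v) = 0 := by linear_combination h1
        exact (mul_eq_zero.1 this).resolve_left h2F
      have hfa : f a ≠ 0 := by rwa [Ne, map_eq_zero]
      obtain ⟨z, hz⟩ := reflect hfa hA (P u) (P v) (by rw [hP, hu]) (by rw [hP, hv]) hB
      have := H2 (ms e') hs'i (by rw [ms_map, val_iff]; exact ⟨z, hz⟩)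
      rw [hcard, Multiset.card_cons, Multiset.card_cons]
      omega

end tower
end HS

namespace HS

section quad

lemma exists_quad {F : Type} [Field F] (c : F) (hc : ∀ r : F, r ^ 2 ≠ c) :
    ∃ (K : Type) (_ : Field K) (_ : Algebra F K) (w : K) (re im : K →ₗ[F] F),
      w ^ 2 = algebraMap F K c ∧ Module.finrank F K = 2 ∧
      (∀ x, x = algebraMap F K (re x) + w * algebraMap F K (im x)) ∧
      (∀ u v : F, algebraMap F K u + w * algebraMap F K v = 0 → u = 0 ∧ v = 0) := by
  haveI : Fact (∀ r : F, r ^ 2 ≠ c + 0 * r) := ⟨fun r => by rw [zero_mul, add_zero]; exact hc r⟩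
  refine ⟨QuadraticAlgebra F c 0, inferInstance, inferInstance, ⟨0, 1⟩,
    { toFun := fun x => x.re, map_add' := fun x y => rfl, map_smul' := fun a x => rfl },
    { toFun := fun x => x.im, map_add' := fun x y => rfl, map_smul' := fun a x => rfl },
    ?_, QuadraticAlgebra.finrank_eq_two _ _, ?_, ?_⟩
  · ext <;> simp [pow_two]
  · intro x
    ext <;> simp
  · intro u v h
    have h1 := congrArg QuadraticAlgebra.re h
    have h3 := congrArg QuadraticAlgebra.im h
    constructor
    · simpa using h1
    · simpa using h3

lemma quad_met {F K : Type} [Field F] [Field K] [Algebra F K] (h2 : (2 : F) ≠ 0) (b : F)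
    (w : K) (re im : K →ₗ[F] F) (hw : w ^ 2 = algebraMap F K (-b))
    (hfr : Module.finrank F K = 2)
    (hx : ∀ x, x = algebraMap F K (re x) + w * algebraMap F K (im x))
    (hu : ∀ u v : F, algebraMap F K u + w * algebraMap F K v = 0 → u = 0 ∧ v = 0)
    {ι : Type} [Fintype ι] (a : F) (d : ι → F) (hd : An (oc a d))
    (hm : MetF (algebraMap F K ∘ oc a d)) : ∃ z, Qd d z = b * a := by
  classical
  obtain ⟨L, hL, hQ⟩ := hm
  haveI : FiniteDimensional F K := FiniteDimensional.of_finrank_pos (by omega)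
  have key : ∀ x : Option ι → K, Qd (algebraMap F K ∘ oc a d) x = 0 →
      Qd (oc a d) (fun i => re (x i)) = b * Qd (oc a d) (fun i => im (x i)) ∧
      Bd (oc a d) (fun i => re (x i)) (fun i => im (x i)) = 0 := by
    intro x h0
    have e : x = algebraMap F K ∘ (fun i => re (x i)) +
        w • (algebraMap F K ∘ (fun i => im (x i))) := by
      funext i; exact hx (x i)
    have hB : ∀ d x y : Option ι → F, Bd (algebraMap F K ∘ d) (algebraMap F K ∘ x)
        (algebraMap F K ∘ y) = algebraMap F K (Bd d x y) := by
      intro d x y; simp [Bd]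
    rw [e, Qd_add, Qd_smul, Bd_smul_right, Qd_map, Qd_map, hB, hw] at h0
    have h1 := hu (Qd (oc a d) (fun i => re (x i)) - b * Qd (oc a d) (fun i => im (x i)))
      (2 * Bd (oc a d) (fun i => re (x i)) (fun i => im (x i))) (by
        rw [← h0]; simp only [map_sub, map_mul, map_neg, map_ofNat]; ring)
    exact ⟨sub_eq_zero.1 h1.1, (mul_eq_zero.1 h1.2).resolve_left h2⟩
  have ha : a ≠ 0 := by
    rintro rfl
    have := hd (oc 1 0) (by rw [Qd_oc]; simp [Qd])
    have := congrFun this none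
    simp at this
  obtain ⟨T, hT⟩ : ∃ T : L →ₗ[F] (Option ι → F), ∀ x i, T x i = im (x.1 i) :=
    ⟨{ toFun := fun x i => im (x.1 i)
       map_add' := fun x y => by funext i; simp
       map_smul' := fun c x => by
        funext i
        have : (c • x).1 i = c • (x.1 i) := rfl
        simp [this] }, fun x i => rfl⟩
  have hinj : Function.Injective T := by
    rw [injective_iff_map_eq_zero]
    intro x hx0
    have him : ∀ i, im (x.1 i) = 0 := fun i => by rw [← hT, hx0]; rfl
    have h1 := (key x.1 (hQ _ x.2)).1
    have h3 : Qd (oc a d) (fun i => im (x.1 i)) = 0 := by simp [him, Qd]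
    rw [h3, mul_zero] at h1
    have h4 := hd _ h1
    apply Subtype.ext
    funext i
    rw [hx (x.1 i), him i, congrFun h4 i]
    simp
  have hfin : Module.finrank F L = 2 * Module.finrank K L := by
    rw [← hfr, Module.finrank_mul_finrank]
  haveI : FiniteDimensional F L := Module.Finite.trans K L
  have hle := LinearMap.finrank_le_finrank_of_injective hinj
  have hsurj : Function.Surjective T := by
    refine (LinearMap.injective_iff_surjective_of_finrank_eq_finrank ?_).1 hinj
    rw [Module.finrank_fintype_fun_eq_card] at hle ⊢
    omega
  obtain ⟨x, hx1⟩ := hsurj (oc 1 0)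
  have him : (fun i => im (x.1 i)) = oc 1 0 := by
    rw [← hx1]; funext i; rw [hT]
  obtain ⟨k1, k3⟩ := key x.1 (hQ _ x.2)
  rw [him] at k1 k3
  have k4 : re (x.1 none) = 0 := by
    have : a * re (x.1 none) = 0 := by
      rw [← k3]; simp [Bd, Fintype.sum_option]
    exact (mul_eq_zero.1 this).resolve_left ha
  rw [Qd_oc, Qd_oc, k4] at k1
  refine ⟨fun i => re (x.1 (some i)), ?_⟩
  have k5 : Qd d (fun i => (oc (1 : F) (0 : ι → F)) (some i)) = 0 := by simp [Qd]
  rw [k5] at k1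
  simp only [oc_none] at k1
  linear_combination k1

lemma isot_of_sq {F : Type} [Field F] {s : Multiset F} {r b : F} (hr : r ≠ 0) (h : Val s b)
    (hb : r ^ 2 = -b) : Isot (1 ::ₘ s) := by
  apply isot_of_val_neg
  have := val_sq r⁻¹ h
  have e : r⁻¹ ^ 2 * b = -1 := by
    have : b = - r ^ 2 := by rw [hb, neg_neg]
    rw [this]; field_simp
  rwa [e] at this

lemma key_ext {k : Type} [Field k] (h2 : (2 : k) ≠ 0) (l : Multiset k) (hl : (0 : k) ∉ l)
    (hl0 : l ≠ 0) (hφ : ¬ Isot (1 ::ₘ l)) :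
    ∃ (K : Type) (_ : Field K) (g : k →+* K), Isot ((1 ::ₘ l).map g) ∧
      ∀ s : Multiset k, ¬ Isot s → Met (s.map g) → s ≠ 0 →
        Multiset.card l + 1 ≤ Multiset.card s := by
  obtain ⟨F, _, f, b, hb, H1, H3, H2⟩ := tower h2 l hl
  have h2F : (2 : F) ≠ 0 := by
    have : f 2 ≠ 0 := by rwa [Ne, map_eq_zero]
    rwa [map_ofNat] at this
  have hnsq : ∀ r : F, r ^ 2 ≠ -b := by
    intro r hr
    by_cases hr0 : r = 0
    · subst hr0
      have hb0 : b = 0 := by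
        have : (0 : F) = - b := by rw [← hr]; simp
        exact neg_eq_zero.1 this.symm
      have := H2 0 (by
        rintro ⟨n, d, hd, x, hx, -⟩
        have hn : n = 0 := by have := ms_card d; rw [hd] at this; simpa using this.symm
        subst hn
        exact hx (Subsingleton.elim _ _)) (by rw [hb0]; exact val_zero _)
      apply hl0
      rw [← Multiset.card_eq_zero]
      simpa using this
    · have := isot_of_sq hr0 hb hr
      refine H1 _ hφ ?_
      rw [Multiset.map_cons, map_one]; exact this
  obtain ⟨K, _, _, w, re, im, hw, hfr, hx, hu⟩ := exists_quad (-b) hnsq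
  refine ⟨K, inferInstance, (algebraMap F K).comp f, ?_, ?_⟩
  · have h1 := val_map (algebraMap F K) hb
    rw [Multiset.map_map] at h1
    rw [Multiset.map_cons, map_one]
    refine isot_of_sq (r := w) ?_ h1 (by rw [hw, map_neg])
    rintro rfl
    have : -b = 0 := by
      have h3 : algebraMap F K (-b) = 0 := by rw [← hw]; simp
      rwa [map_eq_zero] at h3
    exact hnsq 0 (by rw [this]; simp)
  · intro s hs hm hs0
    obtain ⟨c, hc⟩ := Multiset.exists_mem_of_ne_zero hs0
    obtain ⟨s', rfl⟩ := Multiset.exists_cons_of_mem hc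
    have hc0 : c ≠ 0 := by rintro rfl; exact reg_of_not_isot hs hc
    have hAn := H1 _ hs
    have hs' : ¬ Isot s' := fun h => hs (isot_cons_of h)
    have hs'' : ¬ Isot (s'.map (c⁻¹ * ·)) := fun h => hs' (isot_unscale _ (inv_ne_zero hc0) h)
    have hv : Val (s'.map f) (b * f c) := by
      obtain ⟨n, e, rfl⟩ := exists_rep' s'
      rw [Multiset.map_cons, ms_map, ← ms_oc, an_iff] at hAn
      have hm' : MetF (algebraMap F K ∘ oc (f c) (f ∘ e)) := by
        rw [← met_iff, ← ms_map, ms_oc, ← ms_map]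
        simpa [Multiset.map_map] using hm
      rw [ms_map, val_iff]
      exact quad_met h2F b w re im hw hfr hx hu _ _ hAn hm'
    have := H2 _ hs'' (by
      have h3 := val_scale (f c⁻¹) hv
      have e : f c⁻¹ * (b * f c) = b := by
        have : f c ≠ 0 := by rwa [Ne, map_eq_zero]
        rw [map_inv₀]; field_simp
      rw [e] at h3
      simpa [Multiset.map_map, Function.comp_def] using h3)
    rw [Multiset.card_map] at this
    rw [Multiset.card_cons]; omega

end quad
end HS

namespace HS

section haupt

/-- sum of scaled Pfister forms -/
def SS {k : Type} [Field k] (T : List (k × Multiset k)) : Multiset k :=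
  (T.map fun p => (pf p.2).map (p.1 * ·)).sum

lemma SS_cons {k : Type} [Field k] (p : k × Multiset k) (T : List (k × Multiset k)) :
    SS (p :: T) = (pf p.2).map (p.1 * ·) + SS T := by
  simp [SS]

lemma SS_reg {k : Type} [Field k] (T : List (k × Multiset k))
    (hT : ∀ p ∈ T, p.1 ≠ 0 ∧ (0 : k) ∉ p.2) : (0 : k) ∉ SS T := by
  induction T with
  | nil => simp [SS]
  | cons p T ih =>
    rw [SS_cons, Multiset.mem_add, not_or]
    have h := hT p (by simp)
    exact ⟨zero_notMem_scale h.1 (pf_reg h.2), ih fun q hq => hT q (by simp [hq])⟩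

lemma SS_map {k F : Type} [Field k] [Field F] (g : k →+* F) (T : List (k × Multiset k)) :
    (SS T).map g = SS (T.map fun p => (g p.1, p.2.map g)) := by
  induction T with
  | nil => simp [SS]
  | cons p T ih =>
    rw [List.map_cons, SS_cons, SS_cons, Multiset.map_add, ih, ← pf_map]
    simp [Multiset.map_map, Function.comp_def]

lemma haupt (n N : ℕ) : ∀ (k : Type) [Field k] (_ : (2 : k) ≠ 0) (T : List (k × Multiset k)),
    T.length = N → (∀ p ∈ T, p.1 ≠ 0 ∧ (0 : k) ∉ p.2) → (∀ p ∈ T, Multiset.card p.2 = n) →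
    ∀ s : Multiset k, (0 : k) ∉ s → Multiset.card s < 2 ^ n → Met (s + SS T) → Met s := by
  induction N with
  | zero =>
    intro k _ h2 T hT _ _ s _ _ hm
    rw [List.length_eq_zero_iff] at hT
    subst hT
    simpa [SS] using hm
  | succ N ihN =>
    intro k _ h2 T hTl hT hTn
    cases T with
    | nil => simp at hTl
    | cons p T =>
    obtain ⟨c, l⟩ := p
    have hTl' : T.length = N := by simpa using hTl
    have hT' : ∀ p ∈ T, p.1 ≠ 0 ∧ (0 : k) ∉ p.2 := fun q hq => hT q (by simp [hq])
    have hTn' : ∀ p ∈ T, Multiset.card p.2 = n := fun q hq => hTn q (by simp [hq])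
    obtain ⟨hc, hl⟩ : c ≠ 0 ∧ (0 : k) ∉ l := hT (c, l) (by simp)
    have hln : Multiset.card l = n := hTn (c, l) (by simp)
    have main : ∀ M : ℕ, ∀ s : Multiset k, Multiset.card s = M → (0 : k) ∉ s →
        Multiset.card s < 2 ^ n → Met (s + SS ((c, l) :: T)) → Met s := by
      intro M
      induction M using Nat.strong_induction_on with
      | _ M ihM =>
      intro s hsM hs hsn hm
      by_cases hi : Isot s
      · obtain ⟨s', hs'⟩ := isot_split h2 hi hs
        have h1 : Met (1 ::ₘ (-1) ::ₘ s' + SS ((c, l) :: T)) :=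
          (hs'.add (Ch.refl _)).met hm
        rw [Multiset.cons_add, Multiset.cons_add] at h1
        have h3 := met_cancel_pair h2 h1
        have hcard := hs'.card
        simp only [Multiset.card_cons] at hcard
        have hreg := hs'.reg.1 hs
        simp only [Multiset.mem_cons, not_or] at hreg
        have h4 := ihM (Multiset.card s') (by omega) s' rfl hreg.2.2 (by omega) h3
        refine hs'.symm.met ?_
        rw [pair_add]
        exact met_add h4 met_pair
      · have hreg : (0 : k) ∉ (pf l).map (c * ·) := zero_notMem_scale hc (pf_reg hl)
        by_cases hp : Isot (pf l)
        · refine ihN k h2 T hTl' hT' hTn' s hs hsn ?_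
          refine met_cancel h2 (t := (pf l).map (c * ·)) ?_ (met_scale c (pf_met hl hp)) hreg
          rw [SS_cons] at hm
          rw [add_assoc, add_comm (SS T)]; exact hm
        · by_cases hs0 : s = 0
          · rw [hs0]; exact met_zero
          obtain ⟨t, ht⟩ := pf_one l
          have htc := pf_card l
          rw [ht, Multiset.card_cons, hln] at htc
          have hspos : 0 < Multiset.card s := Multiset.card_pos.2 hs0
          have ht0 : t ≠ 0 := by
            rintro rfl
            simp at htc
            omega
          have htr : (0 : k) ∉ t := by
            have := pf_reg hl
            rw [ht] at this
            exact fun h => this (Multiset.mem_cons_of_mem h)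
          obtain ⟨K, _, g, hgi, hg⟩ := key_ext h2 t htr ht0 (by rw [← ht]; exact hp)
          rw [← ht, pf_map] at hgi
          have h2K : (2 : K) ≠ 0 := by
            have : g 2 ≠ 0 := by rwa [Ne, map_eq_zero]
            rwa [map_ofNat] at this
          exfalso
          have hmK := met_map h2 g hm (by
            rw [Multiset.mem_add, not_or]; exact ⟨hs, SS_reg _ hT⟩)
          rw [Multiset.map_add, SS_map, List.map_cons, SS_cons] at hmK
          have hgc : g c ≠ 0 := by rwa [Ne, map_eq_zero]
          have hlK : (0 : K) ∉ l.map g := zero_notMem_map g hl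
          have h5 := ihN K h2K (T.map fun p => (g p.1, p.2.map g)) (by simpa using hTl')
            (by
              intro q hq
              obtain ⟨p, hp, rfl⟩ := List.mem_map.1 hq
              refine ⟨?_, zero_notMem_map g (hT' p hp).2⟩
              change g p.1 ≠ 0
              rw [Ne, map_eq_zero]; exact (hT' p hp).1)
            (by
              intro q hq
              obtain ⟨p, hp, rfl⟩ := List.mem_map.1 hq
              simpa using hTn' p hp)
            (s.map g) (zero_notMem_map g hs) (by simpa using hsn)
            (by
              refine met_cancel h2K (t := (pf (l.map g)).map (g c * ·)) ?_
                (met_scale _ (pf_met hlK hgi)) (zero_notMem_scale hgc (pf_reg hlK))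
              rw [add_assoc, add_comm (SS _)]; exact hmK)
          have := hg s hi h5 hs0
          omega
    intro s hs hsn hm
    exact main _ s rfl hs hsn hm

lemma pf_map_eq {k α : Type} [Field k] (a : α → k) (m : Multiset α) :
    pf (m.map a) = m.powerset.map (fun u => (u.map a).prod) := by
  induction m using Multiset.induction_on with
  | empty => simp [pf]
  | cons x m ih =>
    rw [Multiset.map_cons, pf_cons, ih, Multiset.powerset_cons]
    simp [Multiset.map_map, Function.comp_def]

lemma pf_ms {k : Type} [Field k] {n : ℕ} (a : Fin n → k) :
    ms (fun S : Finset (Fin n) => ∏ u ∈ S, a u) = pf (ms a) := by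
  rw [ms, ms, pf_map_eq]
  have e : (Finset.univ : Finset (Finset (Fin n))) = Finset.univ.powerset := by simp
  have e2 : (Finset.univ : Finset (Fin n)).val.powerset
      = (Finset.univ : Finset (Fin n)).powerset.val.map Finset.val := by
    simp only [Finset.powerset, Multiset.map_pmap]
    rw [Multiset.pmap_eq_map, Multiset.map_id']
  rw [e2, e, Multiset.map_map]
  rfl

lemma ms_prod {k : Type} [Field k] {t : ℕ} {κ : Type} [Fintype κ] (G : Fin t → κ → k) :
    ms (fun p : Fin t × κ => G p.1 p.2) = (List.ofFn fun i => ms (G i)).sum := by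
  rw [List.sum_ofFn]
  unfold ms
  rw [← Finset.univ_product_univ, Finset.product_val]
  simp only [SProd.sprod, Multiset.product, Multiset.map_bind, Multiset.map_map, Function.comp_def]
  rfl

lemma ms_SS {k : Type} [Field k] {t n : ℕ} (c : Fin t → k) (a : Fin t → Fin n → k) :
    ms (fun p : Fin t × Finset (Fin n) => c p.1 * ∏ u ∈ p.2, a p.1 u)
      = SS (List.ofFn fun i => (c i, ms (a i))) := by
  rw [ms_prod (fun i S => c i * ∏ u ∈ S, a i u), SS, List.map_ofFn]
  congr 2
  funext i
  simp only [Function.comp_apply]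
  rw [← pf_ms, ms_map]
  rfl

lemma SS_neg {k : Type} [Field k] (T : List (k × Multiset k)) :
    (SS T).map Neg.neg = SS (T.map fun p => (-p.1, p.2)) := by
  induction T with
  | nil => simp [SS]
  | cons p T ih =>
    rw [List.map_cons, SS_cons, SS_cons, Multiset.map_add, ih]
    simp [Multiset.map_map, Function.comp_def]

lemma ms_hyp {k : Type} [Field k] (m : ℕ) : ms (hypForm k m) = m • ({1, -1} : Multiset k) := by
  induction m with
  | zero => rfl
  | succ m ih =>
    rw [succ_nsmul, ← ih, ms, ms, Fin.univ_val_map, Fin.univ_val_map]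
    have e : List.ofFn (hypForm k (m + 1)) = List.ofFn (hypForm k m) ++ [1, -1] := by
      have : ∀ f : Fin (2 * m + 1 + 1) → k, List.ofFn f = List.ofFn
          (fun i : Fin (2 * m) => f i.castSucc.castSucc) ++
            [f (Fin.last (2 * m)).castSucc, f (Fin.last (2 * m + 1))] := by
        intro f
        rw [List.ofFn_succ', List.ofFn_succ']
        simp
      refine (this (hypForm k (m + 1))).trans ?_
      congr 1
      have e3 : (2 * m + 1) % 2 = 1 := by omega
      simp [hypForm, e3]
    rw [e]
    rfl

lemma neg_met {k : Type} [Field k] {s : Multiset k} (h : Met s) : Met (s.map Neg.neg) := by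
  have := met_scale (-1) h
  simpa using this

lemma reg_neg {k : Type} [Field k] {s : Multiset k} (h : (0 : k) ∉ s) :
    (0 : k) ∉ s.map Neg.neg := by
  have := zero_notMem_scale (c := (-1 : k)) (by simp) h
  simpa using this

lemma ms_reg {k : Type} [Field k] {ι : Type} [Fintype ι] {d : ι → k} (h : ∀ i, d i ≠ 0) :
    (0 : k) ∉ ms d := by
  simp only [ms, Multiset.mem_map, not_exists, not_and]
  exact fun i _ => h i

lemma hyp_reg {k : Type} [Field k] (m : ℕ) : (0 : k) ∉ ms (hypForm k m) := by
  apply ms_reg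
  intro i
  unfold hypForm
  split <;> simp

end haupt
end HS

/-- **Proposition (uniqueness of complementary forms).**  Suppose `q` is an
`I^n`-neighbor of complementary dimension `r` over a field `k` of characteristic ≠ 2.
If `r < 2^(n-1)`, then all `r`-dimensional complementary forms of `q` are isometric. -/
theorem statement4 (k : Type) [Field k] (hchar : ringChar k ≠ 2)
    (n : ℕ) (hn : 1 ≤ n) (m r : ℕ) (d : Fin m → k) (hreg : ∀ t, d t ≠ 0)
    (hrm : r < m) (hr : r < 2 ^ (n - 1))
    (σ σ' : Fin r → k) (hσ : ∀ t, σ t ≠ 0) (hσ' : ∀ t, σ' t ≠ 0)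
    (h1 : inIpow k n (Sum.elim d σ)) (h2 : inIpow k n (Sum.elim d σ')) :
    FormIsom k σ σ' := by
  have h20 : (2 : k) ≠ 0 := Ring.two_ne_zero hchar
  obtain ⟨t1, c1, a1, hc1, ha1, x1, y1, e1⟩ := h1
  obtain ⟨t2, c2, a2, hc2, ha2, x2, y2, e2⟩ := h2
  have m1 := HS.met_graph ((HS.isoF_iff _ _).2 e1)
  have m2 := HS.met_graph ((HS.isoF_iff _ _).2 e2).symm
  simp only [HS.ms_sum, HS.ms_SS, Multiset.map_add, HS.SS_neg] at m1 m2
  have hT1 : ∀ p ∈ List.ofFn (fun i => (c1 i, HS.ms (a1 i))),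
      (p.1 ≠ 0 ∧ (0 : k) ∉ p.2) ∧ Multiset.card p.2 = n := by
    intro p hp
    obtain ⟨i, rfl⟩ := (List.mem_ofFn' _ _).1 hp
    exact ⟨⟨hc1 i, HS.ms_reg (ha1 i)⟩, by simp [HS.ms_card]⟩
  have hT2 : ∀ p ∈ List.ofFn (fun i => (c2 i, HS.ms (a2 i))),
      (p.1 ≠ 0 ∧ (0 : k) ∉ p.2) ∧ Multiset.card p.2 = n := by
    intro p hp
    obtain ⟨i, rfl⟩ := (List.mem_ofFn' _ _).1 hp
    exact ⟨⟨hc2 i, HS.ms_reg (ha2 i)⟩, by simp [HS.ms_card]⟩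
  generalize List.ofFn (fun i => (c1 i, HS.ms (a1 i))) = T1 at *
  generalize List.ofFn (fun i => (c2 i, HS.ms (a2 i))) = T2 at *
  have hT : ∀ p ∈ T1.map (fun p => (-p.1, p.2)) ++ T2,
      (p.1 ≠ 0 ∧ (0 : k) ∉ p.2) ∧ Multiset.card p.2 = n := by
    intro p hp
    rcases List.mem_append.1 hp with h | h
    · obtain ⟨q, hq, rfl⟩ := List.mem_map.1 h
      have := hT1 q hq
      exact ⟨⟨neg_ne_zero.2 this.1.1, this.1.2⟩, this.2⟩
    · exact hT2 p h
  have hSS : HS.SS (T1.map (fun p => (-p.1, p.2)) ++ T2)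
      = HS.SS (T1.map (fun p => (-p.1, p.2))) + HS.SS T2 := by simp [HS.SS]
  have hyp : ∀ j, HS.Met (HS.ms (hypForm k j)) := fun j => by
    rw [HS.ms_hyp]; exact HS.met_nsmul j
  have hcan : HS.Met ((HS.ms σ + (HS.ms σ').map Neg.neg) +
      HS.SS (T1.map (fun p => (-p.1, p.2)) ++ T2)) := by
    refine HS.met_cancel h20 (t := (HS.ms d + (HS.ms d).map Neg.neg) +
      (HS.ms (hypForm k x1) + (HS.ms (hypForm k y1)).map Neg.neg +
        (HS.ms (hypForm k y2) + (HS.ms (hypForm k x2)).map Neg.neg))) ?_ ?_ ?_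
    · rw [hSS]
      have := HS.met_add m1 m2
      convert this using 1
      abel
    · exact HS.met_add (HS.met_self _) (HS.met_add (HS.met_add (hyp _) (HS.neg_met (hyp _)))
        (HS.met_add (hyp _) (HS.neg_met (hyp _))))
    · simp only [Multiset.mem_add, not_or]
      exact ⟨⟨HS.ms_reg hreg, HS.reg_neg (HS.ms_reg hreg)⟩,
        ⟨HS.hyp_reg _, HS.reg_neg (HS.hyp_reg _)⟩, HS.hyp_reg _, HS.reg_neg (HS.hyp_reg _)⟩
  have hpow : 2 ^ n = 2 * 2 ^ (n - 1) := by
    obtain ⟨j, rfl⟩ : ∃ j, n = j + 1 := ⟨n - 1, by omega⟩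
    rw [Nat.add_sub_cancel, pow_succ, mul_comm]
  have hfin := HS.haupt n _ k h20 _ rfl (fun p hp => (hT p hp).1) (fun p hp => (hT p hp).2)
    (HS.ms σ + (HS.ms σ').map Neg.neg)
    (by
      rw [Multiset.mem_add, not_or]
      exact ⟨HS.ms_reg hσ, HS.reg_neg (HS.ms_reg hσ')⟩)
    (by
      rw [Multiset.card_add, Multiset.card_map, HS.ms_card, HS.ms_card, Fintype.card_fin, hpow]
      omega) hcan
  have hch := HS.ch_of_met h20 (HS.ms σ) (HS.ms σ') (by rw [HS.ms_card, HS.ms_card])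
    (HS.ms_reg hσ) (HS.ms_reg hσ') hfin
  exact (HS.isoF_iff _ _).1 ((HS.isoM_iff _ _).1 hch.isoM)
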